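/- arXiv:1307.0453 — 13 statements merged into one kernel-verified Lean document; each statement's English description precedes it below -/
import Mathlib

section
/- Let g ≥ 3 and 2 ≤ k < g, and let N be a (g,k)-reverse multiple with base-g digit list (a_{n-1}, …, a_1, a_0) (so a_0 is the least significant digit, i.e. N mod g, and a_{n-1} is the leading digit). Then a_0 + a_{n-1} ≤ g. -/
/-- `N` is a `(g,k)`-reverse multiple: `N` is positive and reversing its base-`g`
digit list yields the base-`g` expansion of `k * N`. -/
def IsReverseMultiple (g k N : ℕ) : Prop :=
  0 < N ∧ Nat.ofDigits g (Nat.digits g N).reverse = k * N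

/-- If `k * b ≤ a < g` and `k * a ≡ b` modulo `g`, then `a + b ≤ g`. -/
lemma add_le_of_mul_le_of_dvd {g k a b : ℤ} (hk : 2 ≤ k) (hb : 0 ≤ b) (hag : a < g)
    (hba : k * b ≤ a) (hdvd : g ∣ k * a - b) : a + b ≤ g := by
  obtain ⟨c, hc⟩ := hdvd
  have hg : 0 < g := by nlinarith
  have he : k * (g - a) + b = g * (k - c) := by linarith
  have he_pos : 0 < k - c := by
    refine pos_of_mul_pos_right (a := g) ?_ hg.le
    rw [← he]
    nlinarith
  by_contra! h
  nlinarith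

theorem sum_first_last_le (g k N : ℕ) (hg : 3 ≤ g) (hk2 : 2 ≤ k) (hkg : k < g)
    (hN : IsReverseMultiple g k N) :
    N % g + (Nat.digits g N).getLast! ≤ g := by
  obtain ⟨hpos, hrev⟩ := hN
  have hg1 : 1 < g := by omega
  have hne : Nat.digits g N ≠ [] := Nat.digits_ne_nil_iff_ne_zero.mpr hpos.ne'
  obtain ⟨s, b, hs⟩ := (Nat.digits g N).eq_nil_or_concat.resolve_left hne
  have ht := Nat.digits_def' hg1 hpos
  have hNs := Nat.ofDigits_digits g N
  rw [hs, List.concat_eq_append, Nat.ofDigits_append, Nat.ofDigits_singleton] at hNs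
  have hlast : (Nat.digits g N).getLast! = b := by simp [hs, List.getLast!_eq_getLast?_getD]
  have hlow : b + g * Nat.ofDigits g s.reverse = k * N := by
    rw [← hrev, hs]
    simp [Nat.ofDigits_cons]
  have hhigh : Nat.ofDigits g (Nat.digits g (N / g)).reverse + g ^ s.length * (N % g) = k * N := by
    have hlen : (Nat.digits g (N / g)).length = s.length := by
      have := congrArg List.length (ht.symm.trans hs)
      simpa using this
    rw [← hrev, ht, List.reverse_cons, Nat.ofDigits_append, Nat.ofDigits_singleton,
      List.length_reverse, hlen]
  have hlt : Nat.ofDigits g (Nat.digits g (N / g)).reverse < g ^ s.length := by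
    have hlen : (Nat.digits g (N / g)).reverse.length = s.length := by
      have := congrArg List.length (ht.symm.trans hs)
      simpa using this
    rw [← hlen]
    exact Nat.ofDigits_lt_base_pow_length hg1 fun x hx =>
      Nat.digits_lt_base hg1 (List.mem_reverse.mp hx)
  have hba : k * b ≤ N % g := by
    refine Nat.lt_succ_iff.mp (Nat.lt_of_mul_lt_mul_left (a := g ^ s.length) ?_)
    nlinarith [Nat.zero_le (k * Nat.ofDigits g s)]
  rw [hlast]
  have hdvd : (g : ℤ) ∣ k * (N % g : ℕ) - b := by
    refine ⟨Nat.ofDigits g s.reverse - k * (N / g : ℕ), ?_⟩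
    have hdiv : ((N % g : ℕ) : ℤ) + g * (N / g : ℕ) = N := by exact_mod_cast Nat.mod_add_div N g
    have hlow' : (b : ℤ) + g * (Nat.ofDigits g s.reverse : ℕ) = k * N := by exact_mod_cast hlow
    push_cast at *
    linear_combination k * hdiv - hlow'
  exact_mod_cast add_le_of_mul_le_of_dvd (g := g) (k := k) (a := (N % g : ℕ)) (b := b)
    (by exact_mod_cast hk2) (by positivity) (by exact_mod_cast Nat.mod_lt N (by omega))
    (by exact_mod_cast hba) hdvd
end

section
/- Let g ≥ 3 and 2 ≤ k < g, and let N be a (g,k)-reverse multiple with least significant base-g digit a_0 and leading base-g digit a_{n-1}. If a_0 + a_{n-1} = g, then k + 1 divides g. -/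
theorem succ_dvd_of_sum_first_last_eq (g k N : ℕ) (hg : 3 ≤ g) (hk2 : 2 ≤ k) (hkg : k < g)
    (hN : IsReverseMultiple g k N)
    (h : N % g + (Nat.digits g N).getLast! = g) :
    (k + 1) ∣ g := by
  obtain ⟨hpos, hrev⟩ := hN
  have hcons : Nat.digits g N = N % g :: Nat.digits g (N / g) :=
    Nat.digits_def' (by omega) hpos
  obtain ⟨init, b, hinit⟩ : ∃ init b, Nat.digits g N = init ++ [b] := by
    rcases List.eq_nil_or_concat (Nat.digits g N) with h0 | ⟨l, b, hl⟩
    · simp [h0] at hcons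
    · exact ⟨l, b, by simpa using hl⟩
  have hlast : (Nat.digits g N).getLast! = b := by
    rw [hinit, List.getLast!_eq_getLast?_getD]
    simp
  rw [hlast] at h
  have hlen : init.length = (Nat.digits g (N / g)).length := by
    simpa using congrArg List.length (hinit.symm.trans hcons)
  have hmod : k * N ≡ b [MOD g] := by
    rw [← hrev, hinit, List.reverse_append, List.reverse_singleton, List.singleton_append,
      Nat.ofDigits_cons]
    simp [Nat.ModEq]
  have hupper : k * N < g ^ init.length * (N % g + 1) := by
    have hlt : Nat.ofDigits g (Nat.digits g (N / g)).reverse < g ^ init.length := by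
      rw [hlen, ← List.length_reverse]
      refine Nat.ofDigits_lt_base_pow_length (by omega) fun x hx => ?_
      exact Nat.digits_lt_base (by omega) (List.mem_reverse.1 hx)
    rw [← hrev, hcons, List.reverse_cons, Nat.ofDigits_append, Nat.ofDigits_singleton,
      List.length_reverse, ← hlen]
    linarith
  have hlower : g ^ init.length * b ≤ N := by
    have := Nat.ofDigits_digits g N
    rw [hinit, Nat.ofDigits_append, Nat.ofDigits_singleton] at this
    omega
  have hkb : k * b ≤ N % g := by
    refine Nat.lt_succ_iff.1 (Nat.lt_of_mul_lt_mul_left (a := g ^ init.length) ?_)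
    calc g ^ init.length * (k * b) = k * (g ^ init.length * b) := by ring
      _ ≤ k * N := Nat.mul_le_mul_left k hlower
      _ < _ := hupper
  have hb : 0 < b := by
    have := Nat.mod_lt N (show 0 < g by omega)
    omega
  have hdvd : g ∣ (k + 1) * b := by
    have hsum : k * (N % g) + k * b ≡ b + k * b [MOD g] :=
      (((Nat.mod_modEq N g).mul_left k).trans hmod).add_right _
    rw [← mul_add, h] at hsum
    have := (Nat.modEq_zero_iff_dvd.2 (dvd_mul_left g k)).symm.trans hsum
    exact (Nat.modEq_zero_iff_dvd.1 this.symm).trans (by rw [add_mul, one_mul, add_comm])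
  have hle : g ≤ (k + 1) * b := Nat.le_of_dvd (by positivity) hdvd
  exact ⟨b, by linarith⟩
end

section
/- For every integer g ≥ 3, the set of (g, g-1)-reverse multiples is nonempty, and its least element is (g+1)·(g²−1), whose base-g digit expansion (most significant digit first) is (1, 0, g−2, g−1). -/
/-- If `1 + g * x = (g - 1) * (a + g * y)` for a base-`g` digit `a`, then `a = g - 1`. -/
lemma digit_eq_of_one_add_mul_eq {g a x y : ℤ} (ha : 0 ≤ a) (hag : a < g)
    (h : 1 + g * x = (g - 1) * (a + g * y)) : a = g - 1 := by
  have hdvd : g ∣ 1 + a := ⟨a + (g - 1) * y - x, by linarith⟩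
  have := Int.le_of_dvd (by omega) hdvd
  omega

lemma reverse_two_digits_ne {g a b : ℤ} (hg : 3 ≤ g) (hag : a < g) (hb : 0 < b) :
    b + g * a ≠ (g - 1) * (a + g * b) := by
  intro h
  nlinarith [mul_nonneg (sub_nonneg.2 hg) (sub_nonneg.2 hg), mul_pos hb (by linarith : 0 < g),
    mul_nonneg (sub_nonneg.2 (show 1 ≤ b from hb)) (by nlinarith : 0 ≤ g * g - g - 1)]

lemma reverse_three_digits_ne {g a b c : ℤ} (hg : 3 ≤ g) (ha : 0 ≤ a) (hag : a < g)
    (hb : 0 ≤ b) (hbg : b < g) (hc : 0 < c) (hcg : c < g) :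
    c + g * (b + g * a) ≠ (g - 1) * (a + g * (b + g * c)) := by
  intro h
  obtain rfl : c = 1 := by
    by_contra hc1
    have hc2 : 2 ≤ c := by omega
    have h1 : b + g * a < g * g := by nlinarith
    have h2 : c + g * (b + g * a) < g * (g * g) := by nlinarith
    have h3 : g * (g * 2) ≤ a + g * (b + g * c) := by
      have : g * 2 ≤ b + g * c := by nlinarith
      nlinarith
    nlinarith [mul_pos (show 0 < g by omega) (show 0 < g by omega)]
  obtain rfl := digit_eq_of_one_add_mul_eq ha hag h
  nlinarith [mul_nonneg (mul_nonneg hb (by omega : 0 ≤ g)) (by omega : 0 ≤ g - 2)]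

lemma eq_of_reverse_four_digits {g a b c d : ℤ} (hg : 3 ≤ g) (ha : 0 ≤ a) (hag : a < g)
    (hb : 0 ≤ b) (hbg : b < g) (hc : 0 ≤ c) (hcg : c < g) (hd : 0 < d) (hdg : d < g)
    (h : d + g * (c + g * (b + g * a)) = (g - 1) * (a + g * (b + g * (c + g * d)))) :
    a = g - 1 ∧ b = g - 2 ∧ c = 0 ∧ d = 1 := by
  obtain rfl : d = 1 := by
    by_contra hd1
    have hd2 : 2 ≤ d := by omega
    have h1 : b + g * a < g * g := by nlinarith
    have h2 : c + g * (b + g * a) < g * (g * g) := by nlinarith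
    have h3 : d + g * (c + g * (b + g * a)) < g * (g * (g * g)) := by nlinarith
    have h4 : g * 2 ≤ c + g * d := by nlinarith
    have h5 : g * (g * 2) ≤ b + g * (c + g * d) := by nlinarith
    have h6 : g * (g * (g * 2)) ≤ a + g * (b + g * (c + g * d)) := by nlinarith
    have h7 : 0 < g * (g * g) := by positivity
    nlinarith
  obtain rfl := digit_eq_of_one_add_mul_eq ha hag h
  have hbc : b = g - 2 + c * (g * g - g - 1) :=
    mul_left_cancel₀ (by omega : g ≠ 0) (by linarith)
  have hc0 : c = 0 := by
    by_contra hc0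
    have hc1 : 1 ≤ c := by omega
    have hg2 : 2 ≤ g * g - g - 1 := by nlinarith
    nlinarith
  subst hc0
  exact ⟨rfl, by linarith, rfl, rfl⟩

lemma digits_add_one_mul_sq_sub_one {g : ℕ} (hg : 3 ≤ g) :
    Nat.digits g ((g + 1) * (g ^ 2 - 1)) = [g - 1, g - 2, 0, 1] := by
  have h : (g + 1) * (g ^ 2 - 1) = Nat.ofDigits g [g - 1, g - 2, 0, 1] := by
    have hg2 : 1 ≤ g ^ 2 := Nat.one_le_pow _ _ (by omega)
    apply Nat.cast_injective (R := ℤ)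
    simp only [Nat.ofDigits_cons, Nat.ofDigits_nil]
    push_cast [hg2, show 1 ≤ g by omega, show 2 ≤ g by omega]
    ring
  rw [h]
  refine Nat.digits_ofDigits g (by omega) _ ?_ (by simp)
  simp only [List.mem_cons, List.not_mem_nil, or_false]
  omega

lemma IsReverseMultiple.le_of_sub_one {g N : ℕ} (hg : 3 ≤ g)
    (hN : IsReverseMultiple g (g - 1) N) : (g + 1) * (g ^ 2 - 1) ≤ N := by
  obtain ⟨hpos, hrev⟩ := hN
  by_contra! hlt
  have hlen : (Nat.digits g N).length ≤ 4 := by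
    have := Nat.le_length_digits_le g N _ hlt.le
    simpa [digits_add_one_mul_sq_sub_one hg] using this
  have hdig : ∀ x ∈ Nat.digits g N, x < g := fun x hx => Nat.digits_lt_base (by omega) hx
  have hlast : ∀ h : Nat.digits g N ≠ [], (Nat.digits g N).getLast h ≠ 0 :=
    fun _ => Nat.getLast_digit_ne_zero g hpos.ne'
  have hval := Nat.ofDigits_digits g N
  have hne := Nat.digits_ne_nil_iff_ne_zero (b := g).2 hpos.ne'
  generalize Nat.digits g N = L at *
  have hg1 : ((g - 1 : ℕ) : ℤ) = g - 1 := by omega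
  rw [← hval] at hrev hlt
  have hrev' := congrArg (Nat.cast : ℕ → ℤ) hrev
  match L, hlen with
  | [], _ => exact hne rfl
  | [a], _ =>
    simp [Nat.ofDigits_cons, hg1] at hrev' hlast
    have ha : 0 < a := by omega
    zify at hg ha
    nlinarith
  | [a, b], _ =>
    simp [Nat.ofDigits_cons, hg1] at hrev' hlast hdig
    exact reverse_two_digits_ne (by omega) (by omega) (by omega) hrev'
  | [a, b, c], _ =>
    simp [Nat.ofDigits_cons, hg1] at hrev' hlast hdig
    exact reverse_three_digits_ne (by omega) (by omega) (by omega) (by omega) (by omega)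
      (by omega) (by omega) hrev'
  | [a, b, c, d], _ =>
    simp [Nat.ofDigits_cons, hg1] at hrev' hlast hdig
    obtain ⟨ha, hb, hc, hd⟩ := eq_of_reverse_four_digits (by omega) (by omega) (by omega)
      (by omega) (by omega) (by omega) (by omega) (by omega) (by omega) hrev'
    refine hlt.ne ?_
    rw [← Nat.ofDigits_digits g ((g + 1) * (g ^ 2 - 1)), digits_add_one_mul_sq_sub_one hg]
    congr 1
    simp only [List.cons.injEq, and_true]
    omega

theorem least_reverse_multiple_base_g_gsub1 (g : ℕ) (hg : 3 ≤ g) :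
    IsLeast {N | IsReverseMultiple g (g - 1) N} ((g + 1) * (g ^ 2 - 1)) ∧
    Nat.digits g ((g + 1) * (g ^ 2 - 1)) = [g - 1, g - 2, 0, 1] := by
  have hdigits := digits_add_one_mul_sq_sub_one hg
  refine ⟨⟨⟨Nat.pos_of_ne_zero fun h => ?_, ?_⟩, fun N hN => hN.le_of_sub_one hg⟩, hdigits⟩
  · simp [h] at hdigits
  · rw [hdigits]
    have hg2 : 1 ≤ g ^ 2 := Nat.one_le_pow _ _ (by omega)
    apply Nat.cast_injective (R := ℤ)
    simp only [List.reverse_cons, List.reverse_nil, List.nil_append, List.cons_append,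
      Nat.ofDigits_cons, Nat.ofDigits_nil]
    push_cast [hg2, show 1 ≤ g by omega, show 2 ≤ g by omega]
    ring
end

section
/- Let g ≥ 3. A positive integer N is a (g, g−1)-reverse multiple if and only if N = (g²−1)·β, where β is a positive integer whose base-g digit list is palindromic, contains only the digits 0 and 1, and in which every maximal run of consecutive equal digits has length at least 2. -/
/-- Every maximal run of consecutive equal entries of `l` has length at least 2:
`l` decomposes into blocks of repeated values, adjacent blocks having distinct
values (so each block is a maximal run), with every block of length at least 2. -/
def RunsAtLeastTwo (l : List ℕ) : Prop :=
  ∃ blocks : List (ℕ × ℕ),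
    l = (blocks.map fun p => List.replicate p.2 p.1).flatten ∧
    (∀ p ∈ blocks, 2 ≤ p.2) ∧
    blocks.Chain' fun p q => p.1 ≠ q.1

/-- Every entry of `l` agrees with one of its neighbours. -/
def NoIsolated (l : List ℕ) : Prop :=
  ∀ i < l.length, l[i]? = l[i + 1]? ∨ (0 < i ∧ l[i]? = l[i - 1]?)

theorem NoIsolated.replicate_append {k : ℕ} (hk : 2 ≤ k) (x : ℕ) {l : List ℕ}
    (hl : NoIsolated l) : NoIsolated (List.replicate k x ++ l) := by
  intro i hi
  rw [List.length_append, List.length_replicate] at hi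
  rcases lt_or_ge (i + 1) k with h | h
  · left
    rw [List.getElem?_append_left (by simp; omega), List.getElem?_append_left (by simpa)]
    simp [h, (by omega : i < k)]
  rcases lt_or_ge i k with h' | h'
  · right
    refine ⟨by omega, ?_⟩
    rw [List.getElem?_append_left (by simpa), List.getElem?_append_left (by simp; omega)]
    simp [h', (by omega : i - 1 < k)]
  · rcases hl (i - k) (by omega) with h1 | ⟨h0, h1⟩
    · left
      rw [List.getElem?_append_right (by simpa), List.getElem?_append_right (by simpa)]
      simp only [List.length_replicate]
      rw [h1]
      congr 1
      omega
    · right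
      refine ⟨by omega, ?_⟩
      rw [List.getElem?_append_right (by simpa),
        List.getElem?_append_right (by simp; omega)]
      simp only [List.length_replicate]
      rw [h1]
      congr 1
      omega

theorem RunsAtLeastTwo.noIsolated {l : List ℕ} (h : RunsAtLeastTwo l) : NoIsolated l := by
  obtain ⟨blocks, rfl, h2, -⟩ := h
  induction blocks with
  | nil => intro i hi; simp at hi
  | cons p t ih =>
    rw [List.map_cons, List.flatten_cons]
    exact (ih fun q hq => h2 q (by simp [hq])).replicate_append (h2 p (by simp)) p.1

theorem RunsAtLeastTwo.cons_same {x : ℕ} {l : List ℕ} (h : RunsAtLeastTwo (x :: l)) :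
    RunsAtLeastTwo (x :: x :: l) := by
  obtain ⟨blocks, he, h2, hc⟩ := h
  match blocks, he, h2, hc with
  | [], he, _, _ => simp at he
  | (y, k) :: t, he, h2, hc =>
    have hk : 2 ≤ k := h2 (y, k) (by simp)
    obtain ⟨k, rfl⟩ : ∃ m, k = m + 1 := ⟨k - 1, by omega⟩
    rw [List.map_cons, List.flatten_cons, List.replicate_succ, List.cons_append,
      List.cons.injEq] at he
    obtain ⟨rfl, he⟩ := he
    refine ⟨(x, k + 1 + 1) :: t, ?_, ?_, ?_⟩
    · simp [List.replicate_succ, he]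
    · intro p hp
      rcases List.mem_cons.1 hp with rfl | hp
      · simp
      · exact h2 p (by simp [hp])
    · cases t with
      | nil => exact List.isChain_singleton _
      | cons q t =>
        rw [List.Chain', List.isChain_cons_cons] at hc ⊢
        exact hc

theorem RunsAtLeastTwo.cons_cons_of_ne {x z : ℕ} {l : List ℕ} (h : RunsAtLeastTwo (z :: l))
    (hxz : x ≠ z) : RunsAtLeastTwo (x :: x :: z :: l) := by
  obtain ⟨blocks, he, h2, hc⟩ := h
  refine ⟨(x, 2) :: blocks, by rw [he]; simp [List.replicate_succ], ?_, ?_⟩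
  · intro p hp
    rcases List.mem_cons.1 hp with rfl | hp
    · simp
    · exact h2 p hp
  · match blocks, he, h2, hc with
    | [], he, _, _ => simp at he
    | (y, k) :: t, he, h2, hc =>
      have hk : 2 ≤ k := h2 (y, k) (by simp)
      obtain ⟨k, rfl⟩ : ∃ m, k = m + 1 := ⟨k - 1, by omega⟩
      rw [List.map_cons, List.flatten_cons, List.replicate_succ, List.cons_append,
        List.cons.injEq] at he
      rw [List.Chain', List.isChain_cons_cons]
      exact ⟨fun e => hxz (e.trans he.1.symm), hc⟩

theorem NoIsolated.runsAtLeastTwo : ∀ {l : List ℕ}, NoIsolated l → RunsAtLeastTwo l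
  | [], _ => ⟨[], by simp, by simp, List.isChain_nil⟩
  | [x], h => by
    have := h 0 (by simp)
    simp at this
  | [x, y], h => by
    have hxy : x = y := by simpa using h 0 (by simp)
    subst hxy
    exact ⟨[(x, 2)], by simp [List.replicate_succ], by simp, List.isChain_singleton _⟩
  | x :: y :: z :: t, h => by
    have hxy : x = y := by simpa using h 0 (by simp)
    subst hxy
    by_cases hxz : x = z
    · subst hxz
      refine RunsAtLeastTwo.cons_same (NoIsolated.runsAtLeastTwo fun i hi => ?_)
      rcases i with _ | i
      · simp
      · rcases h (i + 2) (by simpa using hi) with h1 | ⟨-, h1⟩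
        · exact Or.inl (by simpa using h1)
        · exact Or.inr ⟨by omega, by simpa using h1⟩
    · refine RunsAtLeastTwo.cons_cons_of_ne (NoIsolated.runsAtLeastTwo fun i hi => ?_) hxz
      rcases i with _ | i
      · rcases h 2 (by simp) with h1 | ⟨-, h1⟩
        · exact Or.inl (by simpa using h1)
        · simp at h1
          omega
      · rcases h (i + 3) (by simpa using hi) with h1 | ⟨-, h1⟩
        · exact Or.inl (by simpa using h1)
        · exact Or.inr ⟨by omega, by simpa using h1⟩
termination_by l => l.length

theorem ofDigits_map_range (g n : ℕ) (f : ℕ → ℕ) :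
    Nat.ofDigits g ((List.range n).map f) = ∑ i ∈ Finset.range n, f i * g ^ i := by
  induction n with
  | zero => simp
  | succ n ih =>
    simp [List.range_succ, Nat.ofDigits_append, Finset.sum_range_succ, ih, mul_comm]

theorem reverse_map_range (n : ℕ) (f : ℕ → ℕ) :
    ((List.range n).map f).reverse = (List.range n).map fun i => f (n - 1 - i) := by
  apply List.ext_getElem <;> simp

theorem map_getD_range (l : List ℕ) : (List.range l.length).map (fun i => l.getD i 0) = l := by
  apply List.ext_getElem
  · simp
  · intro i h1 h2
    simp [h2]

theorem ofDigits_div_pow_mod {g : ℕ} (hg : 0 < g) {l : List ℕ} (hl : ∀ d ∈ l, d < g) (i : ℕ) :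
    Nat.ofDigits g l / g ^ i % g = l.getD i 0 := by
  rw [Nat.ofDigits_div_pow_eq_ofDigits_drop i hg l hl, Nat.ofDigits_mod_eq_head!]
  rcases lt_or_ge i l.length with h | h
  · rw [List.drop_eq_getElem_cons h, List.head!_cons, List.getD_eq_getElem _ _ h,
      Nat.mod_eq_of_lt (hl _ (List.getElem_mem h))]
  · simp [List.drop_eq_nil_of_le h, h]

/-- Summation of a three-term linear combination of shifts of `B` against powers of `g`. -/
theorem sum_shift_combination (g p q r : ℤ) (B : ℕ → ℤ) (h0 : B 0 = 0) (h1 : B 1 = 0) (m : ℕ) :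
    ∑ i ∈ Finset.range m, (p * B (i + 2) + q * B (i + 1) + r * B i) * g ^ i =
      (p + q * g + r * g ^ 2) * ∑ i ∈ Finset.range m, B (i + 2) * g ^ i
        - q * g ^ m * B (m + 1) - r * g ^ (m + 1) * B (m + 1) - r * g ^ m * B m := by
  induction m with
  | zero => simp [h0, h1]
  | succ m ih =>
    rw [Finset.sum_range_succ, ih, Finset.sum_range_succ]
    ring

/-- The sequence obtained from a carry sequence `c` by dividing out `1 - x + x ^ 2`. -/
def carryQuotient (c : ℕ → ℤ) : ℕ → ℤ
  | 0 => 0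
  | 1 => 0
  | i + 2 => carryQuotient c (i + 1) - carryQuotient c i + c (i + 1)

theorem carryQuotient_invariant {g : ℤ} (hg : 3 ≤ g) {L : ℕ} {A c : ℕ → ℤ}
    (hA0 : ∀ i, 0 ≤ A i) (hA1 : ∀ i, A i < g) (hc : ∀ i, c i = 0 ∨ c i = 1)
    (hAz : A 0 = 0) (hcz : c 0 = 0) (hAL : A L = 1) (hcL : c L = 1)
    (hstep : ∀ i < L, A (i + 1) + A (L - i) + c i = A i + g * c (i + 1)) :
    ∀ i ≤ L, A i = (g - 2) * carryQuotient c (i + 1) + c i ∧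
      A (L - i) = (g - 2) * carryQuotient c i + c (L - i) ∧
      (carryQuotient c i = 0 ∨ carryQuotient c i = 1) ∧
      (carryQuotient c (i + 1) = 0 ∨ carryQuotient c (i + 1) = 1) := by
  intro i
  induction i with
  | zero => simp [carryQuotient, hAz, hcz, hAL, hcL]
  | succ i ih =>
    intro hi
    obtain ⟨e1, e2, hp, hq⟩ := ih (by omega)
    have s1 := hstep i (by omega)
    have s2 := hstep (L - 1 - i) (by omega)
    rw [show L - 1 - i + 1 = L - i by omega, show L - (L - 1 - i) = i + 1 by omega,
      show L - 1 - i = L - (i + 1) by omega] at s2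
    have hB : carryQuotient c (i + 1 + 1) =
      carryQuotient c (i + 1) - carryQuotient c i + c (i + 1) := rfl
    have a0 := hA0 (i + 1)
    have a1 := hA1 (i + 1)
    have b0 := hA0 (L - (i + 1))
    have b1 := hA1 (L - (i + 1))
    rw [hB]
    generalize carryQuotient c (i + 1) = q at *
    generalize carryQuotient c i = p at *
    generalize A (i + 1) = A1 at *
    generalize A (L - (i + 1)) = A2 at *
    generalize A (L - i) = A3 at *
    generalize A i = A4 at *
    rcases hc i with h1 | h1 <;> rcases hc (i + 1) with h2 | h2 <;>
    rcases hc (L - i) with h3 | h3 <;> rcases hc (L - (i + 1)) with h4 | h4 <;>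
    rw [h1, h2] at s1 <;> rw [h3, h4] at s2 <;> rw [h1] at e1 <;> rw [h3] at e2 <;>
    rw [h2, h4] <;>
    rcases hp with rfl | rfl <;> rcases hq with rfl | rfl <;>
    first
    | (exfalso; linarith)
    | (refine ⟨by linarith, by linarith, by norm_num, by norm_num⟩)

theorem NoIsolated.second_difference_mem {l : List ℕ} (h : NoIsolated l)
    (hl : ∀ d ∈ l, d = 0 ∨ d = 1) (B : ℕ → ℤ) (h0 : B 0 = 0) (h1 : B 1 = 0)
    (hB : ∀ i, B (i + 2) = l.getD i 0) (i : ℕ) :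
    (B i = 0 ∨ B i = 1) ∧
      (B (i + 2) - B (i + 1) + B i = 0 ∨ B (i + 2) - B (i + 1) + B i = 1) := by
  have hbit : ∀ j, l.getD j 0 = 0 ∨ l.getD j 0 = 1 := by
    intro j
    rcases lt_or_ge j l.length with hj | hj
    · rw [List.getD_eq_getElem _ _ hj]
      exact hl _ (List.getElem_mem hj)
    · simp [hj]
  have hnb : ∀ j < l.length, l.getD j 0 = l.getD (j + 1) 0 ∨
      (0 < j ∧ l.getD j 0 = l.getD (j - 1) 0) := by
    intro j hj
    simp only [List.getD_eq_getElem?_getD]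
    rcases h j hj with e | ⟨e0, e⟩
    · left; rw [e]
    · right; exact ⟨e0, by rw [e]⟩
  have hout : ∀ j, l.length ≤ j → l.getD j 0 = 0 := by
    intro j hj
    simp [hj]
  rcases i with _ | _ | i
  · simp only [zero_add, h0, h1, hB 0]
    have := hbit 0
    exact ⟨Or.inl trivial, by omega⟩
  · simp only [zero_add, h1]
    rw [hB 1, show 1 + 1 = 0 + 2 from rfl, hB 0]
    have b0 := hbit 0
    have b1 := hbit 1
    have n0 := hnb 0
    have o0 := hout 0
    simp only [zero_add] at n0
    exact ⟨Or.inl trivial, by omega⟩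
  · rw [hB i, show i + 1 + 1 + 2 = (i + 2) + 2 from rfl, hB (i + 2),
      show i + 1 + 1 + 1 = (i + 1) + 2 from rfl, hB (i + 1)]
    have b0 := hbit i
    have b1 := hbit (i + 1)
    have b2 := hbit (i + 2)
    have n1 := hnb (i + 1)
    have o1 := hout (i + 1)
    have o2 := hout (i + 2)
    simp only [Nat.add_sub_cancel] at n1
    rw [show i + 1 + 1 = i + 2 from rfl] at n1
    omega

theorem isReverseMultiple_of_palindrome {g : ℕ} (hg : 3 ≤ g) {β : ℕ} (hβ : 0 < β)
    (hpal : (Nat.digits g β).reverse = Nat.digits g β)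
    (hbits : ∀ d ∈ Nat.digits g β, d = 0 ∨ d = 1) (hruns : RunsAtLeastTwo (Nat.digits g β)) :
    IsReverseMultiple g (g - 1) ((g ^ 2 - 1) * β) := by
  set l := Nat.digits g β with hl
  set n := l.length with hn
  have hne : l ≠ [] := by
    rw [hl, Nat.digits_ne_nil_iff_ne_zero]
    omega
  have hn0 : 0 < n := List.length_pos_iff.2 hne
  let B : ℕ → ℤ := fun i => if i < 2 then 0 else (l.getD (i - 2) 0 : ℤ)
  have hB0 : B 0 = 0 := rfl
  have hB1 : B 1 = 0 := rfl
  have hB : ∀ i, B (i + 2) = l.getD i 0 := fun i => by simp [B]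
  have hloc := hruns.noIsolated.second_difference_mem hbits B hB0 hB1 hB
  have hBn : ∀ i, n ≤ i → B (i + 2) = 0 := fun i hi => by rw [hB]; simp [← hn, hi]
  have hsymm : ∀ i < n, l.getD i 0 = l.getD (n - 1 - i) 0 := by
    intro i hi
    conv_lhs => rw [← hpal]
    rw [List.getD_eq_getElem _ _ (by simpa using hi), List.getElem_reverse,
      List.getD_eq_getElem _ _ (by omega)]
  have hBsymm : ∀ i ≤ n + 3, B i = B (n + 3 - i) := by
    intro i hi
    rcases lt_or_ge i 2 with h | h
    · rw [show n + 3 - i = (n + 1 - i) + 2 by omega, hBn _ (by omega)]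
      interval_cases i <;> assumption
    rcases lt_or_ge (n + 1) i with h' | h'
    · rw [show i = (i - 2) + 2 by omega, hBn _ (by omega)]
      obtain h3 | h3 : n + 3 - (i - 2 + 2) = 0 ∨ n + 3 - (i - 2 + 2) = 1 := by omega
      · rw [h3, hB0]
      · rw [h3, hB1]
    · rw [show i = (i - 2) + 2 by omega, hB,
        show n + 3 - (i - 2 + 2) = (n - 1 - (i - 2)) + 2 by omega, hB, hsymm _ (by omega)]
  have htop : B (n + 1) = 1 := by
    rw [show n + 1 = (n - 1) + 2 by omega, hB, List.getD_eq_getElem _ _ (by omega)]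
    have h1 := hbits _ (List.getElem_mem (show n - 1 < l.length by omega))
    have h2 := Nat.getLast_digit_ne_zero g (show β ≠ 0 by omega)
    rw [List.getLast_eq_getElem] at h2
    have h3 : l[n - 1] ≠ 0 := h2
    have h4 : l[n - 1] = 1 := by omega
    exact_mod_cast h4
  have hgz : (3 : ℤ) ≤ g := by exact_mod_cast hg
  let a : ℕ → ℕ := fun i => (((g : ℤ) - 1) * B (i + 2) + (-1) * B (i + 1) + 1 * B i).toNat
  have hpos : ∀ i, 0 ≤ ((g : ℤ) - 1) * B (i + 2) + (-1) * B (i + 1) + 1 * B i ∧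
      ((g : ℤ) - 1) * B (i + 2) + (-1) * B (i + 1) + 1 * B i < g := by
    intro i
    obtain ⟨b0, hd⟩ := hloc i
    have b2 := (hloc (i + 2)).1
    rcases b2 with h | h <;> rw [h] at hd ⊢ <;> rcases hd with hd | hd <;>
      constructor <;> linarith
  have ha : ∀ i, (a i : ℤ) = ((g : ℤ) - 1) * B (i + 2) + (-1) * B (i + 1) + 1 * B i :=
    fun i => Int.toNat_of_nonneg (hpos i).1
  have hS : ∑ i ∈ Finset.range (n + 2), B (i + 2) * (g : ℤ) ^ i = β := by
    rw [Finset.sum_range_succ, Finset.sum_range_succ, hBn n le_rfl, hBn (n + 1) (by omega)]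
    have := ofDigits_map_range g n fun i => l.getD i 0
    rw [hn, map_getD_range, hl, Nat.ofDigits_digits] at this
    rw [this]
    push_cast
    simp [hB, hn, hl]
  have hBa : B (n + 2) = 0 := hBn n le_rfl
  have hBb : B (n + 2 + 1) = 0 := hBn (n + 1) (by omega)
  have hg2 : 1 ≤ g ^ 2 := Nat.one_le_pow _ _ (by omega)
  have hsum : Nat.ofDigits g ((List.range (n + 2)).map a) = (g ^ 2 - 1) * β := by
    rw [ofDigits_map_range]
    zify [hg2]
    simp_rw [ha]
    rw [sum_shift_combination _ _ _ _ B hB0 hB1, hS, hBa, hBb]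
    ring
  have hdig : Nat.digits g ((g ^ 2 - 1) * β) = (List.range (n + 2)).map a := by
    rw [← hsum]
    apply Nat.digits_ofDigits g (by omega)
    · intro d hd
      obtain ⟨i, -, rfl⟩ := List.mem_map.1 hd
      have := (hpos i).2
      rw [← ha] at this
      exact_mod_cast this
    · intro _
      have h1 := ha (n + 1)
      rw [show n + 1 + 2 = n + 2 + 1 from rfl, hBb, show n + 1 + 1 = n + 2 from rfl, hBa,
        htop] at h1
      have h2 : a (n + 1) = 1 := by exact_mod_cast (by simpa using h1 : (a (n + 1) : ℤ) = 1)
      simp [List.range_succ, h2]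
  refine ⟨Nat.mul_pos ?_ hβ, ?_⟩
  · have : 3 ^ 2 ≤ g ^ 2 := Nat.pow_le_pow_left hg 2
    omega
  rw [hdig, reverse_map_range, ofDigits_map_range]
  zify [hg2, (by omega : 1 ≤ g)]
  have hrev : ∀ i ∈ Finset.range (n + 2), (a (n + 2 - 1 - i) : ℤ) * (g : ℤ) ^ i =
      (1 * B (i + 2) + (-1) * B (i + 1) + ((g : ℤ) - 1) * B i) * (g : ℤ) ^ i := by
    intro i hi
    rw [Finset.mem_range] at hi
    rw [ha, hBsymm (n + 2 - 1 - i + 2) (by omega), hBsymm (n + 2 - 1 - i + 1) (by omega),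
      hBsymm (n + 2 - 1 - i) (by omega),
      show n + 3 - (n + 2 - 1 - i + 2) = i by omega,
      show n + 3 - (n + 2 - 1 - i + 1) = i + 1 by omega,
      show n + 3 - (n + 2 - 1 - i) = i + 2 by omega]
    ring
  rw [Finset.sum_congr rfl hrev, sum_shift_combination _ _ _ _ B hB0 hB1, hS, hBa, hBb]
  ring

theorem add_div_sub_mem (x y : ℕ) {m : ℕ} (hm : 0 < m) :
    (((x + y) / m : ℕ) : ℤ) - (x / m : ℕ) - (y / m : ℕ) = 0 ∨
      (((x + y) / m : ℕ) : ℤ) - (x / m : ℕ) - (y / m : ℕ) = 1 := by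
  rw [Nat.add_div hm]
  split_ifs <;> push_cast <;> omega

theorem noIsolated_of_second_difference {l : List ℕ} (B : ℕ → ℤ) (h1 : B 1 = 0)
    (hB : ∀ i, i ≤ l.length → B (i + 2) = l.getD i 0)
    (hbit : ∀ i ≤ l.length + 2, B i = 0 ∨ B i = 1)
    (hd : ∀ i ≤ l.length, B (i + 2) - B (i + 1) + B i = 0 ∨ B (i + 2) - B (i + 1) + B i = 1)
    (hfirst : l.getD 0 0 = 1) (hlast : l.getD (l.length - 1) 0 = 1) : NoIsolated l := by
  intro i hi
  have hout : l.getD l.length 0 = 0 := by simp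
  have e1 := hB i hi.le
  have e2 := hB (i + 1) (by omega)
  have d1 := hd (i + 1) (by omega)
  have b1 := hbit (i + 1) (by omega)
  have b2 := hbit (i + 1 + 1) (by omega)
  have b3 := hbit (i + 1 + 2) (by omega)
  rw [show i + 1 + 1 = i + 2 from rfl] at d1 b2
  rw [List.getElem?_eq_getElem hi]
  rw [List.getD_eq_getElem _ _ hi] at e1
  rcases eq_or_ne (i + 1) l.length with hend | hend
  · right
    rw [show l.length - 1 = i by omega, List.getD_eq_getElem _ _ hi] at hlast
    rw [hend, hout, ← hend] at e2
    rcases i with _ | i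
    · simp only [zero_add] at *
      omega
    · have e0 := hB i (by omega)
      rw [show i + 1 + 1 = i + 2 from rfl] at *
      rw [List.getD_eq_getElem _ _ (by omega)] at e0
      refine ⟨by omega, ?_⟩
      rw [Nat.add_sub_cancel, List.getElem?_eq_getElem (by omega)]
      congr 1
      omega
  · have hi' : i + 1 < l.length := by omega
    rw [List.getD_eq_getElem _ _ hi'] at e2
    rw [List.getElem?_eq_getElem hi']
    rcases i with _ | i
    · left
      rw [List.getD_eq_getElem _ _ hi] at hfirst
      congr 1
      simp only [zero_add] at *
      omega
    · have e0 := hB i (by omega)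
      rw [List.getD_eq_getElem _ _ (by omega)] at e0
      rw [Nat.add_sub_cancel, List.getElem?_eq_getElem (show i < l.length by omega)]
      rw [← show i + 1 + 1 = i + 2 from rfl] at e0
      simp only [Option.some.injEq]
      omega

theorem IsReverseMultiple.exists_palindrome {g : ℕ} (hg : 3 ≤ g) {N : ℕ}
    (h : IsReverseMultiple g (g - 1) N) :
    ∃ β : ℕ, 0 < β ∧ N = (g ^ 2 - 1) * β ∧
      (Nat.digits g β).reverse = Nat.digits g β ∧
      (∀ d ∈ Nat.digits g β, d = 0 ∨ d = 1) ∧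
      RunsAtLeastTwo (Nat.digits g β) := by
  obtain ⟨hN, hrev⟩ := h
  set R := (g - 1) * N with hR
  obtain ⟨L, hL⟩ : ∃ L, L = (Nat.digits g N).length := ⟨_, rfl⟩
  have hgN : g * N = N + R := by
    obtain ⟨k, rfl⟩ : ∃ k, g = k + 1 := ⟨g - 1, by omega⟩
    rw [hR, Nat.add_sub_cancel]
    ring
  have hg0 : 0 < g := by omega
  have hpow : ∀ i, 0 < g ^ i := fun i => Nat.pow_pos hg0
  have hL0 : 0 < L := by
    rw [hL, List.length_pos_iff, Nat.digits_ne_nil_iff_ne_zero]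
    omega
  have hNlt : N < g ^ L := hL ▸ Nat.lt_base_pow_length_digits (by omega)
  have hRlt : R < g ^ L := by
    rw [← hrev, hL, ← List.length_reverse]
    refine Nat.ofDigits_lt_base_pow_length (by omega) fun d hd => ?_
    exact Nat.digits_lt_base (by omega) (List.mem_reverse.1 hd)
  have hRdig : ∀ i < L, R / g ^ i % g = N / g ^ (L - 1 - i) % g := by
    intro i hi
    rw [hL] at hi ⊢
    rw [← hrev, ofDigits_div_pow_mod hg0
      (fun d hd => Nat.digits_lt_base (by omega) (List.mem_reverse.1 hd)),
      ← Nat.getD_digits _ _ (by omega),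
      List.getD_eq_getElem _ _ (by simpa using hi), List.getElem_reverse,
      List.getD_eq_getElem _ _ (by omega)]
  have hshift : ∀ i, g * N / g ^ (i + 1) = N / g ^ i := by
    intro i
    rw [pow_succ', Nat.mul_div_mul_left _ _ hg0]
  let A : ℕ → ℤ := fun i => ((g * N / g ^ i % g : ℕ) : ℤ)
  let c : ℕ → ℤ := fun i => ((g * N / g ^ i : ℕ) : ℤ) - (N / g ^ i : ℕ) - (R / g ^ i : ℕ)
  have hc : ∀ i, c i = 0 ∨ c i = 1 := by
    intro i
    simp only [c, hgN]
    exact add_div_sub_mem N R (hpow i)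
  have hAsucc : ∀ i, A (i + 1) = (N / g ^ i % g : ℕ) := fun i => by simp only [A, hshift]
  have hA0 : ∀ i, 0 ≤ A i := fun i => Int.natCast_nonneg _
  have hA1 : ∀ i, A i < g := fun i => Int.ofNat_lt.2 (Nat.mod_lt _ hg0)
  have hAz : A 0 = 0 := by simp [A]
  have hcz : c 0 = 0 := by
    simp only [c, pow_zero, Nat.div_one, hgN]
    push_cast
    ring
  have hNtop : g ^ (L - 1) ≤ N := by
    by_contra! hlt
    have := (Nat.digits_length_le_iff (by omega : 1 < g) N).2 hlt
    omega
  have hcL' : c L = (N / g ^ (L - 1) : ℕ) := by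
    have := hshift (L - 1)
    rw [Nat.sub_add_cancel hL0] at this
    simp only [c, Nat.div_eq_of_lt hNlt, Nat.div_eq_of_lt hRlt, this, Nat.cast_zero, sub_zero]
  have htop : N / g ^ (L - 1) = 1 := by
    have h1 : 0 < N / g ^ (L - 1) := Nat.div_pos hNtop (hpow _)
    have h2 := hc L
    omega
  have hcL : c L = 1 := by rw [hcL', htop]; rfl
  have hAL : A L = 1 := by
    have := hAsucc (L - 1)
    rw [Nat.sub_add_cancel hL0, htop, Nat.mod_eq_of_lt (by omega)] at this
    simpa using this
  have hmod : ∀ x i : ℕ, ((x / g ^ i % g : ℕ) : ℤ) =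
      (x / g ^ i : ℕ) - g * (x / g ^ (i + 1) : ℕ) := by
    intro x i
    have := Nat.mod_add_div (x / g ^ i) g
    rw [Nat.div_div_eq_div_mul, ← pow_succ] at this
    rw [eq_sub_iff_add_eq]
    exact_mod_cast this
  have hstep : ∀ i < L, A (i + 1) + A (L - i) + c i = A i + g * c (i + 1) := by
    intro i hi
    have h1 : A (L - i) = (R / g ^ i % g : ℕ) := by
      rw [show L - i = L - 1 - i + 1 by omega, hAsucc, hRdig i hi]
    rw [hAsucc, h1]
    simp only [A, c]
    rw [hmod, hmod, hmod]
    ring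
  have hgz : (3 : ℤ) ≤ g := by exact_mod_cast hg
  have hinv := carryQuotient_invariant hgz hA0 hA1 hc hAz hcz hAL hcL hstep
  set B := carryQuotient c with hBdef
  have hB0 : B 0 = 0 := rfl
  have hB1 : B 1 = 0 := rfl
  have hBrec : ∀ i, B (i + 2) = B (i + 1) - B i + c (i + 1) := fun i => rfl
  have hbit : ∀ i ≤ L + 1, B i = 0 ∨ B i = 1 := by
    intro i hi
    rcases i with _ | i
    · exact Or.inl rfl
    · exact (hinv i (by omega)).2.2.2
  have hsymm : ∀ i ≤ L, B i = B (L + 1 - i) := by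
    intro i hi
    have e1 := (hinv i hi).2.1
    have e2 := (hinv (L - i) (by omega)).1
    rw [show L - i + 1 = L + 1 - i by omega] at e2
    have h2 : ((g : ℤ) - 2) * B i = (g - 2) * B (L + 1 - i) := by linarith
    exact mul_left_cancel₀ (by omega) h2
  have hBL1 : B (L + 1) = 0 := (hsymm 0 (by omega)).symm
  have hBL : B L = 0 := (hsymm 1 hL0).symm
  have hc1 : c 1 = 1 := by
    have h1 := hstep 0 hL0
    have h2 := hA0 1
    rw [Nat.sub_zero, hAL, hcz, hAz, zero_add] at h1
    rcases hc 1 with h3 | h3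
    · rw [h3] at h1
      linarith
    · exact h3
  have hB2 : B 2 = 1 := by rw [hBrec 0, hB0, hB1, hc1]; rfl
  have hL3 : 3 ≤ L := by
    by_contra! hlt
    interval_cases L
    · rw [hBL1] at hB2
      omega
    · rw [hBL] at hB2
      omega
  obtain ⟨n, rfl⟩ : ∃ n, L = n + 2 := ⟨L - 2, by omega⟩
  let b : ℕ → ℕ := fun i => (B (i + 2)).toNat
  have hb : ∀ i ≤ n + 1, (b i : ℤ) = B (i + 2) := by
    intro i hi
    apply Int.toNat_of_nonneg
    have := hbit (i + 2) (by omega)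
    omega
  have hb01 : ∀ i ≤ n + 1, b i = 0 ∨ b i = 1 := by
    intro i hi
    have := hbit (i + 2) (by omega)
    rw [← hb i hi] at this
    exact_mod_cast this
  have hbsymm : ∀ i < n, b (n - 1 - i) = b i := by
    intro i hi
    zify
    rw [hb _ (by omega), hb _ (by omega), hsymm (i + 2) (by omega)]
    congr 1
    omega
  have hb0 : b 0 = 1 := by
    zify
    rw [hb 0 (by omega), hB2]
  have hblast : b (n - 1) = 1 := by
    have := hbsymm 0 (by omega)
    rwa [Nat.sub_zero, hb0] at this
  set l := (List.range n).map b with hl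
  have hlen : l.length = n := by simp [hl]
  have hget : ∀ i < n, l.getD i 0 = b i := by
    intro i hi
    rw [List.getD_eq_getElem _ _ (by omega)]
    simp [hl]
  have hl01 : ∀ d ∈ l, d = 0 ∨ d = 1 := by
    intro d hd
    obtain ⟨i, hi, rfl⟩ := List.mem_map.1 hd
    exact hb01 i (by have := List.mem_range.1 hi; omega)
  have hdig : Nat.digits g (Nat.ofDigits g l) = l := by
    apply Nat.digits_ofDigits g (by omega)
    · intro d hd
      have := hl01 d hd
      omega
    · intro hne
      rw [List.getLast_eq_getElem, ← List.getD_eq_getElem l 0, hlen, hget _ (by omega), hblast]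
      omega
  have hg2 : 1 ≤ g ^ 2 := Nat.one_le_pow _ _ (by omega)
  have hNeq : N = (g ^ 2 - 1) * Nat.ofDigits g l := by
    have h1 : N = ∑ i ∈ Finset.range (n + 2), (N / g ^ i % g) * g ^ i := by
      rw [← ofDigits_map_range]
      conv_lhs => rw [← Nat.ofDigits_digits g N, ← map_getD_range (Nat.digits g N), ← hL]
      congr 2
      funext i
      exact Nat.getD_digits _ _ (by omega)
    have h2 : ∀ i ∈ Finset.range (n + 2), ((N / g ^ i % g : ℕ) : ℤ) * (g : ℤ) ^ i =
        (((g : ℤ) - 1) * B (i + 2) + (-1) * B (i + 1) + 1 * B i) * (g : ℤ) ^ i := by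
      intro i hi
      have hi' := Finset.mem_range.1 hi
      rw [← hAsucc, (hinv (i + 1) (by omega)).1]
      have := hBrec i
      rw [show i + 1 + 1 = i + 2 from rfl, show c (i + 1) = B (i + 2) - B (i + 1) + B i by linarith]
      ring
    have h3 : ∑ i ∈ Finset.range (n + 2), B (i + 2) * (g : ℤ) ^ i = (Nat.ofDigits g l : ℕ) := by
      rw [Finset.sum_range_succ, Finset.sum_range_succ, hBL, show n + 1 + 2 = n + 2 + 1 from rfl,
        hBL1, hl, ofDigits_map_range]
      push_cast
      rw [zero_mul, zero_mul, add_zero, add_zero]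
      refine Finset.sum_congr rfl fun i hi => ?_
      rw [hb i (by have := Finset.mem_range.1 hi; omega)]
    have h4 : (N : ℤ) = ((g : ℤ) ^ 2 - 1) * (Nat.ofDigits g l : ℕ) := by
      conv_lhs => rw [h1]
      rw [Nat.cast_sum]
      simp_rw [Nat.cast_mul, Nat.cast_pow]
      rw [Finset.sum_congr rfl h2, sum_shift_combination _ _ _ _ B hB0 hB1, h3, hBL, hBL1]
      ring
    zify [hg2]
    exact_mod_cast h4
  refine ⟨Nat.ofDigits g l, ?_, hNeq, ?_, ?_, ?_⟩
  · rcases Nat.eq_zero_or_pos (Nat.ofDigits g l) with h | h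
    · rw [h, mul_zero] at hNeq
      omega
    · exact h
  · rw [hdig, hl, reverse_map_range]
    exact List.map_congr_left fun i hi => hbsymm i (List.mem_range.1 hi)
  · rwa [hdig]
  · rw [hdig]
    apply NoIsolated.runsAtLeastTwo
    refine noIsolated_of_second_difference B hB1 ?_ ?_ ?_ ?_ ?_
    · intro i hi
      rcases eq_or_ne i n with rfl | hne
      · rw [hBL]
        simp [hlen]
      · rw [hget i (by omega), hb i (by omega)]
    · intro i hi
      exact hbit i (by omega)
    · intro i hi
      have := hBrec i
      rw [show B (i + 2) - B (i + 1) + B i = c (i + 1) by linarith]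
      exact hc _
    · rw [hget 0 (by omega), hb0]
    · rw [hlen, hget _ (by omega), hblast]

theorem reverse_multiple_iff_palindromic (g : ℕ) (hg : 3 ≤ g) (N : ℕ) (hN : 0 < N) :
    IsReverseMultiple g (g - 1) N ↔
      ∃ β : ℕ, 0 < β ∧ N = (g ^ 2 - 1) * β ∧
        (Nat.digits g β).reverse = Nat.digits g β ∧
        (∀ d ∈ Nat.digits g β, d = 0 ∨ d = 1) ∧
        RunsAtLeastTwo (Nat.digits g β) := by
  constructor
  · exact IsReverseMultiple.exists_palindrome hg
  · rintro ⟨β, hβ, rfl, hpal, hbits, hruns⟩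
    exact isReverseMultiple_of_palindrome hg hβ hpal hbits hruns
end

section
/- Let g ≥ 3 and let t ≥ 4 be an integer. The number of (g, g−1)-reverse multiples having exactly t base-g digits equals the Fibonacci number F_{⌊t/2⌋−1} (with F_1 = F_2 = 1); moreover for t < 4 there are no (g, g−1)-reverse multiples with exactly t base-g digits. -/
/-- Base-`(q + 2)` digit lists of length `n`, least significant digit first, on which
multiplication by `q + 1` with incoming carry `r` produces the reversed list and outgoing
carry `s`. -/
def reversalSolutions (q n r s : ℕ) : Set (List ℕ) :=
  {l | l.length = n ∧ (∀ d ∈ l, d < q + 2) ∧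
    (q + 1) * Nat.ofDigits (q + 2) l + r
      = Nat.ofDigits (q + 2) l.reverse + s * (q + 2) ^ n}

/-- Surround a list by a first and a last entry. -/
def surround (x y : ℕ) (m : List ℕ) : List ℕ := x :: (m ++ [y])

theorem surround_inj {x y x' y' : ℕ} {m m' : List ℕ} :
    surround x y m = surround x' y' m' ↔ x = x' ∧ m = m' ∧ y = y' := by
  simp [surround]

theorem surround_injective (x y : ℕ) : Function.Injective (surround x y) :=
  fun _ _ h => (surround_inj.1 h).2.1

theorem exists_eq_surround {n : ℕ} {l : List ℕ} (h : l.length = n + 2) :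
    ∃ x y m, m.length = n ∧ l = surround x y m := by
  obtain _ | ⟨x, l⟩ := l
  · simp at h
  · obtain rfl | ⟨m, y, rfl⟩ := l.eq_nil_or_concat
    · simp at h
    · exact ⟨x, y, m, by simpa using h, by simp [surround]⟩

theorem ofDigits_surround (b x y : ℕ) (m : List ℕ) :
    Nat.ofDigits b (surround x y m)
      = x + b * (Nat.ofDigits b m + b ^ m.length * y) := by
  simp [surround, Nat.ofDigits_cons, Nat.ofDigits_append]

theorem reverse_surround (x y : ℕ) (m : List ℕ) :
    (surround x y m).reverse = surround y x m.reverse := by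
  simp [surround]

/-- Peeling off the outer digits of a solution leaves a solution for new carries. -/
theorem surround_mem_reversalSolutions {q n r s x y : ℕ} {m : List ℕ} (hr : r ≤ q)
    (hm : m.length = n) :
    surround x y m ∈ reversalSolutions q (n + 2) r s ↔
      x < q + 2 ∧ y < q + 2 ∧ ∃ r' s', r' ≤ q ∧ s' ≤ q ∧
        (q + 1) * x + r = y + (q + 2) * r' ∧ (q + 1) * y + s' = x + (q + 2) * s ∧
        m ∈ reversalSolutions q n r' s' := by
  have key : surround x y m ∈ reversalSolutions q (n + 2) r s ↔
      x < q + 2 ∧ y < q + 2 ∧ (∀ d ∈ m, d < q + 2) ∧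
      (q + 1) * (x + (q + 2) * (Nat.ofDigits (q + 2) m + (q + 2) ^ n * y)) + r
        = y + (q + 2) * (Nat.ofDigits (q + 2) m.reverse + (q + 2) ^ n * x)
          + s * (q + 2) ^ (n + 2) := by
    simp only [reversalSolutions, Set.mem_ofPred_eq, ofDigits_surround, reverse_surround,
      List.length_reverse, hm]
    simp only [surround, List.length_cons, List.length_append, hm, List.mem_cons,
      List.mem_append, List.length_nil, List.not_mem_nil, or_false]
    constructor
    · rintro ⟨-, h, e⟩
      exact ⟨h x (by simp), h y (by simp), fun d hd => h d (by simp [hd]), e⟩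
    · rintro ⟨hx, hy, h, e⟩
      refine ⟨trivial, ?_, e⟩
      rintro d (rfl | hd | rfl)
      exacts [hx, h d hd, hy]
  rw [key]
  refine and_congr_right fun hx => and_congr_right fun hy => ?_
  have hpow : (q + 2) ^ (n + 2) = (q + 2) * ((q + 2) * (q + 2) ^ n) := by ring
  simp only [reversalSolutions, Set.mem_ofPred_eq]
  constructor
  · rintro ⟨hd, e⟩
    have hB : Nat.ofDigits (q + 2) m < (q + 2) ^ n :=
      hm ▸ Nat.ofDigits_lt_base_pow_length (by omega) hd
    have hC : Nat.ofDigits (q + 2) m.reverse < (q + 2) ^ n := by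
      have := Nat.ofDigits_lt_base_pow_length (b := q + 2) (l := m.reverse) (by omega)
        (by simpa using hd)
      simpa [hm] using this
    rw [hpow] at e
    generalize Nat.ofDigits (q + 2) m = B at *
    generalize Nat.ofDigits (q + 2) m.reverse = C at *
    generalize (q + 2) ^ n = p at *
    have hmod : ((q + 1) * x + r) % (q + 2) = y := by
      have h := congrArg (· % (q + 2)) e
      have h1 : (q + 1) * (x + (q + 2) * (B + p * y)) + r
          = (q + 1) * x + r + (q + 2) * ((q + 1) * (B + p * y)) := by ring
      have h2 : y + (q + 2) * (C + p * x) + s * ((q + 2) * ((q + 2) * p))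
          = y + (q + 2) * (C + p * x + s * ((q + 2) * p)) := by ring
      simpa [h1, h2, Nat.mod_eq_of_lt hy] using h
    obtain ⟨r', hr'⟩ : ∃ r', (q + 1) * x + r = y + (q + 2) * r' :=
      ⟨_, by conv_lhs => rw [← Nat.mod_add_div ((q + 1) * x + r) (q + 2), hmod]⟩
    have hr'q : r' ≤ q := by
      by_contra! h
      nlinarith
    have e' : (q + 1) * B + r' + (q + 1) * y * p = C + (x + (q + 2) * s) * p := by
      apply Nat.eq_of_mul_eq_mul_left (show 0 < q + 2 by omega)
      linarith
    have hle : (q + 1) * y ≤ x + (q + 2) * s := by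
      by_contra! h
      have : (x + (q + 2) * s + 1) * p ≤ (q + 1) * y * p := Nat.mul_le_mul_right _ h
      nlinarith
    obtain ⟨s', hs'⟩ := Nat.exists_eq_add_of_le hle
    rw [hs'] at e'
    have e'' : (q + 1) * B + r' = C + s' * p := by linarith
    have hs'q : s' ≤ q := by
      by_contra! h
      have : (q + 1) * p ≤ s' * p := Nat.mul_le_mul_right _ h
      nlinarith
    exact ⟨r', s', hr'q, hs'q, hr', hs'.symm, hm, hd, e''⟩
  · rintro ⟨r', s', -, -, h1, h2, -, hd, e⟩
    refine ⟨hd, ?_⟩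
    rw [hpow]
    generalize Nat.ofDigits (q + 2) m = B at *
    generalize Nat.ofDigits (q + 2) m.reverse = C at *
    generalize (q + 2) ^ n = p at *
    linear_combination h1 + (q + 2) * e + (q + 2) * p * h2

/-- The carry equations for a pair of opposite digits, in linear form. -/
theorem carry_step_iff {q x y r s r' s' : ℕ} (hx : x < q + 2) (hy : y < q + 2)
    (hr : r ≤ q) (hs' : s' ≤ q) :
    ((q + 1) * x + r = y + (q + 2) * r' ∧ (q + 1) * y + s' = x + (q + 2) * s) ↔
      (x = r' ∧ x + y = r ∨ x = r' + 1 ∧ x + y = r + q + 2) ∧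
      (y = s ∧ x + y = s' ∨ y = s + 1 ∧ x + y = s' + q + 2) := by
  have aux : ∀ {u v c d : ℕ}, u < q + 2 → v < q + 2 → c ≤ q →
      ((q + 1) * u + c = v + (q + 2) * d ↔
        u = d ∧ u + v = c ∨ u = d + 1 ∧ u + v = c + q + 2) := by
    intro u v c d hu hv hc
    constructor
    · intro h
      have h1 : d ≤ u := by
        by_contra! hlt
        nlinarith
      obtain ⟨k, rfl⟩ := Nat.exists_eq_add_of_le h1
      have h2 : (q + 2) * k + c = d + k + v := by linarith
      have h3 : k < 2 := by
        by_contra! hlt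
        nlinarith
      interval_cases k <;> omega
    · rintro (⟨rfl, rfl⟩ | ⟨rfl, h⟩)
      · ring
      · linarith
  rw [aux hx hy hr, aux hy hx hs', add_comm y x]

theorem reversalSolutions_zero_zero {q : ℕ} (hq : 1 ≤ q) (n : ℕ) :
    reversalSolutions q (n + 2) 0 0 =
      surround 0 0 '' reversalSolutions q n 0 0 ∪
      surround (q + 1) 1 '' reversalSolutions q n q 0 := by
  ext l
  constructor
  · intro h
    obtain ⟨x, y, m, hm, rfl⟩ := exists_eq_surround h.1
    obtain ⟨hx, hy, r', s', hr', hs', h1, h2, hmem⟩ :=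
      (surround_mem_reversalSolutions (by omega) hm).1 h
    have := (carry_step_iff hx hy (by omega) hs').1 ⟨h1, h2⟩
    have : x = 0 ∧ y = 0 ∧ r' = 0 ∧ s' = 0 ∨
        x = q + 1 ∧ y = 1 ∧ r' = q ∧ s' = 0 := by omega
    rcases this with ⟨rfl, rfl, rfl, rfl⟩ | ⟨rfl, rfl, rfl, rfl⟩
    exacts [.inl ⟨m, hmem, rfl⟩, .inr ⟨m, hmem, rfl⟩]
  · rintro (⟨m, hm, rfl⟩ | ⟨m, hm, rfl⟩) <;>
      refine (surround_mem_reversalSolutions (by omega) hm.1).2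
        ⟨by omega, by omega, _, _, ?_, ?_, ?_, ?_, hm⟩ <;> first | omega | ring

theorem reversalSolutions_left {q : ℕ} (hq : 1 ≤ q) (n : ℕ) :
    reversalSolutions q (n + 2) q 0 = surround q 0 '' reversalSolutions q n q q := by
  ext l
  constructor
  · intro h
    obtain ⟨x, y, m, hm, rfl⟩ := exists_eq_surround h.1
    obtain ⟨hx, hy, r', s', hr', hs', h1, h2, hmem⟩ :=
      (surround_mem_reversalSolutions (by omega) hm).1 h
    have := (carry_step_iff hx hy (by omega) hs').1 ⟨h1, h2⟩
    obtain ⟨rfl, rfl, rfl, rfl⟩ : x = q ∧ y = 0 ∧ r' = q ∧ s' = q := by omega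
    exact ⟨m, hmem, rfl⟩
  · rintro ⟨m, hm, rfl⟩
    refine (surround_mem_reversalSolutions (by omega) hm.1).2
        ⟨by omega, by omega, _, _, ?_, ?_, ?_, ?_, hm⟩ <;> first | omega | ring

theorem reversalSolutions_both {q : ℕ} (hq : 1 ≤ q) (n : ℕ) :
    reversalSolutions q (n + 2) q q =
      surround (q + 1) (q + 1) '' reversalSolutions q n q q ∪
      surround 0 q '' reversalSolutions q n 0 q := by
  ext l
  constructor
  · intro h
    obtain ⟨x, y, m, hm, rfl⟩ := exists_eq_surround h.1
    obtain ⟨hx, hy, r', s', hr', hs', h1, h2, hmem⟩ :=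
      (surround_mem_reversalSolutions (by omega) hm).1 h
    have := (carry_step_iff hx hy (by omega) hs').1 ⟨h1, h2⟩
    have : x = q + 1 ∧ y = q + 1 ∧ r' = q ∧ s' = q ∨
        x = 0 ∧ y = q ∧ r' = 0 ∧ s' = q := by omega
    rcases this with ⟨rfl, rfl, h3, h4⟩ | ⟨rfl, rfl, h3, h4⟩ <;> rw [h3, h4] at hmem
    exacts [.inl ⟨m, hmem, rfl⟩, .inr ⟨m, hmem, rfl⟩]
  · rintro (⟨m, hm, rfl⟩ | ⟨m, hm, rfl⟩) <;>
      refine (surround_mem_reversalSolutions (by omega) hm.1).2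
        ⟨by omega, by omega, _, _, ?_, ?_, ?_, ?_, hm⟩ <;> first | omega | ring

theorem reversalSolutions_right {q : ℕ} (hq : 1 ≤ q) (n : ℕ) :
    reversalSolutions q (n + 2) 0 q = surround 1 (q + 1) '' reversalSolutions q n 0 0 := by
  ext l
  constructor
  · intro h
    obtain ⟨x, y, m, hm, rfl⟩ := exists_eq_surround h.1
    obtain ⟨hx, hy, r', s', hr', hs', h1, h2, hmem⟩ :=
      (surround_mem_reversalSolutions (by omega) hm).1 h
    have := (carry_step_iff hx hy (by omega) hs').1 ⟨h1, h2⟩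
    obtain ⟨rfl, rfl, rfl, rfl⟩ : x = 1 ∧ y = q + 1 ∧ r' = 0 ∧ s' = 0 := by omega
    exact ⟨m, hmem, rfl⟩
  · rintro ⟨m, hm, rfl⟩
    refine (surround_mem_reversalSolutions (by omega) hm.1).2
        ⟨by omega, by omega, _, _, ?_, ?_, ?_, ?_, hm⟩ <;> first | omega | ring

theorem disjoint_image_surround {x y x' y' : ℕ} (h : x ≠ x') (s t : Set (List ℕ)) :
    Disjoint (surround x y '' s) (surround x' y' '' t) := by
  rw [Set.disjoint_left]
  rintro _ ⟨m, -, rfl⟩ ⟨m', -, h'⟩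
  exact h (surround_inj.1 h').1.symm

theorem mem_reversalSolutions_zero {q r s : ℕ} {l : List ℕ} :
    l ∈ reversalSolutions q 0 r s ↔ l = [] ∧ r = s := by
  simp only [reversalSolutions, Set.mem_ofPred_eq, List.length_eq_zero_iff]
  constructor
  · rintro ⟨rfl, -, h⟩
    simpa using h
  · rintro ⟨rfl, rfl⟩
    simp

theorem mem_reversalSolutions_one {q r s : ℕ} {l : List ℕ} :
    l ∈ reversalSolutions q 1 r s ↔ ∃ x < q + 2, l = [x] ∧ q * x + r = s * (q + 2) := by
  simp only [reversalSolutions, Set.mem_ofPred_eq, List.length_eq_one_iff]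
  constructor
  · rintro ⟨⟨x, rfl⟩, hx, h⟩
    simp only [List.reverse_singleton, Nat.ofDigits_singleton, pow_one] at h
    exact ⟨x, by simpa using hx, rfl, by linarith⟩
  · rintro ⟨x, hx, rfl, h⟩
    refine ⟨⟨x, rfl⟩, by simpa using hx, ?_⟩
    simp only [List.reverse_singleton, Nat.ofDigits_singleton, pow_one]
    linarith

theorem encard_reversalSolutions {q : ℕ} (hq : 1 ≤ q) (n : ℕ) :
    (reversalSolutions q n 0 0).encard = Nat.fib (n / 2 + 1) ∧
    (reversalSolutions q n q q).encard = Nat.fib (n / 2 + 1) ∧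
    (reversalSolutions q n q 0).encard = Nat.fib (n / 2) ∧
    (reversalSolutions q n 0 q).encard = Nat.fib (n / 2) := by
  induction n using Nat.twoStepInduction with
  | zero =>
    have h1 (r : ℕ) : reversalSolutions q 0 r r = {[]} := by
      ext l
      simp [mem_reversalSolutions_zero]
    have h2 {r s : ℕ} (h : r ≠ s) : reversalSolutions q 0 r s = ∅ := by
      ext l
      simp [mem_reversalSolutions_zero, h]
    simp [h1, h2 (show q ≠ 0 by omega), h2 (show 0 ≠ q by omega)]
  | one =>
    have h1 : reversalSolutions q 1 0 0 = {[0]} := by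
      ext l
      simp only [mem_reversalSolutions_one, Set.mem_singleton_iff]
      constructor
      · rintro ⟨x, hx, rfl, h⟩
        have : x = 0 := by nlinarith
        rw [this]
      · rintro rfl
        exact ⟨0, by omega, rfl, by simp⟩
    have h2 : reversalSolutions q 1 q q = {[q + 1]} := by
      ext l
      simp only [mem_reversalSolutions_one, Set.mem_singleton_iff]
      constructor
      · rintro ⟨x, hx, rfl, h⟩
        have : q * (x + 1) = q * (q + 2) := by linarith
        have := Nat.eq_of_mul_eq_mul_left hq this
        rw [show x = q + 1 by omega]
      · rintro rfl
        exact ⟨q + 1, by omega, rfl, by ring⟩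
    have h3 : reversalSolutions q 1 q 0 = ∅ := by
      ext l
      simp only [mem_reversalSolutions_one, Set.mem_empty_iff_false, iff_false]
      rintro ⟨x, hx, rfl, h⟩
      omega
    have h4 : reversalSolutions q 1 0 q = ∅ := by
      ext l
      simp only [mem_reversalSolutions_one, Set.mem_empty_iff_false, iff_false]
      rintro ⟨x, hx, rfl, h⟩
      exact hx.ne (Nat.eq_of_mul_eq_mul_left hq h)
    simp [h1, h2, h3, h4]
  | more n ih _ =>
    obtain ⟨h1, h2, h3, h4⟩ := ih
    have hfib : Nat.fib ((n + 2) / 2 + 1) = Nat.fib (n / 2 + 1) + Nat.fib (n / 2) := by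
      rw [show (n + 2) / 2 + 1 = n / 2 + 2 by omega, Nat.fib_add_two, add_comm]
    rw [hfib, show (n + 2) / 2 = n / 2 + 1 by omega, reversalSolutions_zero_zero hq,
      reversalSolutions_both hq, reversalSolutions_left hq, reversalSolutions_right hq,
      Set.encard_union_eq (disjoint_image_surround (by omega) _ _),
      Set.encard_union_eq (disjoint_image_surround (by omega) _ _)]
    simp only [(surround_injective _ _).encard_image, h1, h2, h3, h4, Nat.cast_add,
      and_self]

theorem isReverseMultiple_iff {q n N : ℕ} :
    IsReverseMultiple (q + 2) (q + 1) N ∧ (Nat.digits (q + 2) N).length = n ↔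
      0 < N ∧ Nat.digits (q + 2) N ∈ reversalSolutions q n 0 0 := by
  simp only [IsReverseMultiple, reversalSolutions, Set.mem_ofPred_eq, Nat.ofDigits_digits,
    add_zero, zero_mul]
  constructor
  · rintro ⟨⟨h0, h⟩, hl⟩
    exact ⟨h0, hl, fun d hd => Nat.digits_lt_base (by omega) hd, h.symm⟩
  · rintro ⟨h0, hl, -, h⟩
    exact ⟨⟨h0, h.symm⟩, hl⟩

theorem setOf_isReverseMultiple_eq_image {q : ℕ} (hq : 1 ≤ q) (n : ℕ) :
    {N : ℕ | IsReverseMultiple (q + 2) (q + 1) N ∧ (Nat.digits (q + 2) N).length = n + 2} =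
      (Nat.ofDigits (q + 2) ∘ surround (q + 1) 1) '' reversalSolutions q n q 0 := by
  ext N
  rw [Set.mem_ofPred_eq, isReverseMultiple_iff, reversalSolutions_zero_zero hq]
  constructor
  · rintro ⟨h0, ⟨m, hm, h⟩ | ⟨m, hm, h⟩⟩
    · have := Nat.getLast_digit_ne_zero (q + 2) h0.ne'
      simp [← h, surround] at this
    · exact ⟨m, hm, by rw [Function.comp_apply, h, Nat.ofDigits_digits]⟩
  · rintro ⟨m, hm, rfl⟩
    have hdig : Nat.digits (q + 2) (Nat.ofDigits (q + 2) (surround (q + 1) 1 m))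
        = surround (q + 1) 1 m := by
      refine Nat.digits_ofDigits _ (by omega) _ ?_ (by simp [surround])
      simp only [surround, List.mem_cons, List.mem_append, List.not_mem_nil, or_false]
      rintro d (rfl | hd | rfl)
      exacts [by omega, hm.2.1 d hd, by omega]
    rw [Function.comp_apply]
    refine ⟨?_, by rw [hdig]; exact .inr ⟨m, hm, rfl⟩⟩
    rw [ofDigits_surround]
    omega

theorem encard_setOf_isReverseMultiple {q : ℕ} (hq : 1 ≤ q) (n : ℕ) :
    {N : ℕ | IsReverseMultiple (q + 2) (q + 1) N ∧
      (Nat.digits (q + 2) N).length = n + 2}.encard = Nat.fib (n / 2) := by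
  rw [setOf_isReverseMultiple_eq_image hq, Set.InjOn.encard_image,
    (encard_reversalSolutions hq n).2.2.1]
  intro m hm m' hm' h
  rw [Function.comp_apply, Function.comp_apply, ofDigits_surround, ofDigits_surround,
    hm.1, hm'.1] at h
  have h' := Nat.eq_of_mul_eq_mul_left (by omega) (Nat.add_left_cancel h)
  exact Nat.ofDigits_inj_of_len_eq (by omega) (hm.1.trans hm'.1.symm) hm.2.1 hm'.2.1
    (Nat.add_right_cancel h')

theorem count_reverse_multiples_base_g_gsub1 (g t : ℕ) (hg : 3 ≤ g) :
    (4 ≤ t →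
      {N : ℕ | IsReverseMultiple g (g - 1) N ∧ (Nat.digits g N).length = t}.ncard
        = Nat.fib (t / 2 - 1)) ∧
    (t < 4 →
      {N : ℕ | IsReverseMultiple g (g - 1) N ∧ (Nat.digits g N).length = t} = ∅) := by
  obtain ⟨q, rfl⟩ := Nat.exists_eq_add_of_le' (show 2 ≤ g by omega)
  have hq : 1 ≤ q := by omega
  rw [show q + 2 - 1 = q + 1 by omega]
  refine ⟨fun ht => ?_, fun ht => ?_⟩
  · obtain ⟨n, rfl⟩ := Nat.exists_eq_add_of_le' (show 2 ≤ t by omega)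
    rw [Set.ncard, encard_setOf_isReverseMultiple hq, ENat.toNat_natCast,
      show (n + 2) / 2 - 1 = n / 2 by omega]
  · obtain h | h := lt_or_ge t 2
    · rw [Set.eq_empty_iff_forall_notMem]
      intro N hN
      obtain ⟨h0, hmem⟩ := isReverseMultiple_iff.1 hN
      have hN' := Nat.ofDigits_digits (q + 2) N
      interval_cases t
      · rw [(mem_reversalSolutions_zero.1 hmem).1, Nat.ofDigits_nil] at hN'
        omega
      · obtain ⟨x, -, hx, hx'⟩ := mem_reversalSolutions_one.1 hmem
        rw [hx, Nat.ofDigits_singleton] at hN'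
        subst hN'
        have := Nat.mul_pos hq h0
        omega
    · obtain ⟨n, rfl⟩ := Nat.exists_eq_add_of_le' h
      rw [← Set.encard_eq_zero, encard_setOf_isReverseMultiple hq,
        show n / 2 = 0 by omega, Nat.fib_zero, Nat.cast_zero]
end

section
/- Let g ≥ 3 and 2 ≤ k < g, and suppose k + 1 divides g; set b = g/(k+1). Then the number N_0 = b·(g+1)·(g²−1), whose base-g digit expansion (most significant digit first) is (b, b−1, kb−1, kb), is a (g,k)-reverse multiple. -/
theorem N0_is_reverse_multiple (g k : ℕ) (hg : 3 ≤ g) (hk2 : 2 ≤ k) (hkg : k < g)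
    (hdvd : (k + 1) ∣ g) :
    IsReverseMultiple g k (g / (k + 1) * (g + 1) * (g ^ 2 - 1)) ∧
    Nat.digits g (g / (k + 1) * (g + 1) * (g ^ 2 - 1)) =
      [k * (g / (k + 1)), k * (g / (k + 1)) - 1, g / (k + 1) - 1, g / (k + 1)] := by
  obtain ⟨b, hb⟩ := hdvd
  have hdiv : g / (k + 1) = b := by rw [hb, Nat.mul_div_cancel_left _ k.succ_pos]
  have hb0 : 0 < b := Nat.pos_of_ne_zero (by rintro rfl; omega)
  have hkb : k * b + b = g := by rw [hb]; ring
  have hkb0 : 0 < k * b := by positivity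
  have hsq : 1 < g ^ 2 := by nlinarith
  rw [hdiv]
  have hN : b * (g + 1) * (g ^ 2 - 1) = Nat.ofDigits g [k * b, k * b - 1, b - 1, b] := by
    simp only [Nat.ofDigits_cons, Nat.ofDigits_nil]
    zify [hsq.le, Nat.succ_le_of_lt hkb0, Nat.succ_le_of_lt hb0]
    rw [← hkb]
    push_cast
    ring
  have hdigits : Nat.digits g (b * (g + 1) * (g ^ 2 - 1)) = [k * b, k * b - 1, b - 1, b] := by
    rw [hN]
    apply Nat.digits_ofDigits g (by omega)
    · simp only [List.mem_cons, List.not_mem_nil, or_false]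
      rintro d (rfl | rfl | rfl | rfl) <;> omega
    · intro _
      simpa using hb0.ne'
  refine ⟨⟨Nat.mul_pos (by positivity) (by omega), ?_⟩, hdigits⟩
  rw [hdigits]
  simp only [List.reverse_cons, List.reverse_nil, List.nil_append, List.cons_append,
    Nat.ofDigits_cons, Nat.ofDigits_nil]
  zify [hsq.le, Nat.succ_le_of_lt hkb0, Nat.succ_le_of_lt hb0]
  rw [← hkb]
  push_cast
  ring
end

section
/- Let g ≥ 3 and 2 ≤ k < g, and suppose k + 1 divides g; set b = g/(k+1). Then for every integer n ≥ 4, the number W_n = b·(g²−1)·(g^{n−2}−1)/(g−1), whose base-g digit expansion (most significant digit first) is (b, b−1, g−1, …, g−1, kb−1, kb) with n−4 copies of g−1 in the middle, is a (g,k)-reverse multiple with exactly n base-g digits. -/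
theorem ofDigits_replicate_pred_add_one (g j : ℕ) (hg : 0 < g) :
    Nat.ofDigits g (List.replicate j (g - 1)) + 1 = g ^ j := by
  induction j with
  | zero => simp
  | succ j ih =>
    rw [List.replicate_succ, Nat.ofDigits_cons, pow_succ, ← ih]
    obtain ⟨a, rfl⟩ : ∃ a, g = a + 1 := ⟨g - 1, by omega⟩
    simp only [Nat.add_sub_cancel]
    ring

theorem ofDigits_pair_replicate_pred_pair (g j x y z w : ℕ) (hg : 0 < g) :
    Nat.ofDigits g ([x, y] ++ List.replicate j (g - 1) ++ [z, w]) + g ^ 2 =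
      x + y * g + g ^ (j + 2) + z * g ^ (j + 2) + w * g ^ (j + 3) := by
  simp only [Nat.ofDigits_append, List.length_append, List.length_replicate, List.length_cons,
    List.length_nil, Nat.ofDigits_cons, Nat.ofDigits_nil]
  have h := ofDigits_replicate_pred_add_one g j hg
  generalize Nat.ofDigits g (List.replicate j (g - 1)) = r at *
  have e2 : g ^ (j + 2) = (r + 1) * g ^ 2 := by rw [h]; ring
  have e3 : g ^ (j + 3) = (r + 1) * g ^ 3 := by rw [h]; ring
  have e2' : g ^ (0 + 1 + 1 + j) = (r + 1) * g ^ 2 := by rw [h]; ring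
  rw [e2, e3, e2']
  ring

theorem sq_sub_one_mul_repunit_add (g m : ℕ) (hg : 2 ≤ g) :
    (g ^ 2 - 1) * ((g ^ m - 1) / (g - 1)) + (g + 1) = (g + 1) * g ^ m := by
  have hdvd : (g - 1) ∣ g ^ m - 1 := by
    simpa using Nat.sub_dvd_pow_sub_pow g 1 m
  have hsq : g ^ 2 - 1 = (g + 1) * (g - 1) := by
    simpa using Nat.sq_sub_sq g 1
  have hpos : 1 ≤ g ^ m := Nat.one_le_pow _ _ (by omega)
  rw [hsq, mul_assoc, Nat.mul_div_cancel' hdvd]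
  obtain ⟨p, hp⟩ : ∃ p, g ^ m = p + 1 := ⟨g ^ m - 1, by omega⟩
  rw [hp, Nat.add_sub_cancel]
  ring

theorem Wn_is_reverse_multiple (g k n : ℕ) (hg : 3 ≤ g) (hk2 : 2 ≤ k) (hkg : k < g)
    (hdvd : (k + 1) ∣ g) (hn : 4 ≤ n) :
    IsReverseMultiple g k (g / (k + 1) * (g ^ 2 - 1) * ((g ^ (n - 2) - 1) / (g - 1))) ∧
    Nat.digits g (g / (k + 1) * (g ^ 2 - 1) * ((g ^ (n - 2) - 1) / (g - 1))) =
      [k * (g / (k + 1)), k * (g / (k + 1)) - 1] ++ List.replicate (n - 4) (g - 1) ++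
        [g / (k + 1) - 1, g / (k + 1)] ∧
    (Nat.digits g (g / (k + 1) * (g ^ 2 - 1) * ((g ^ (n - 2) - 1) / (g - 1)))).length = n := by
  obtain ⟨j, rfl⟩ : ∃ j, n = j + 4 := ⟨n - 4, by omega⟩
  have hb : (k + 1) * (g / (k + 1)) = g := Nat.mul_div_cancel' hdvd
  have hbpos : 0 < g / (k + 1) := Nat.div_pos hkg (by omega)
  rw [show j + 4 - 2 = j + 2 by omega, show j + 4 - 4 = j by omega, mul_assoc]
  have hW := sq_sub_one_mul_repunit_add g (j + 2) (by omega)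
  generalize (g ^ 2 - 1) * ((g ^ (j + 2) - 1) / (g - 1)) = R at *
  generalize g / (k + 1) = b at *
  have hkb : 0 < k * b := by positivity
  have hbg : k * b + b = g := by rw [← hb]; ring
  have hval := ofDigits_pair_replicate_pred_pair g j (k * b) (k * b - 1) (b - 1) b (by omega)
  have hrev := ofDigits_pair_replicate_pred_pair g j b (b - 1) (k * b - 1) (k * b) (by omega)
  have hN : Nat.ofDigits g ([k * b, k * b - 1] ++ List.replicate j (g - 1) ++ [b - 1, b]) =
      b * R := by
    zify [Nat.one_le_iff_ne_zero.2 hkb.ne', Nat.one_le_iff_ne_zero.2 hbpos.ne'] at hval hW hbg ⊢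
    linear_combination hval - b * hW + (g + 1) * hbg
  have hM : Nat.ofDigits g ([b, b - 1] ++ List.replicate j (g - 1) ++ [k * b - 1, k * b]) =
      k * (b * R) := by
    zify [Nat.one_le_iff_ne_zero.2 hkb.ne', Nat.one_le_iff_ne_zero.2 hbpos.ne'] at hrev hW hbg ⊢
    linear_combination hrev - k * b * hW + (g + 1) * hbg
  have hdig : Nat.digits g (b * R) =
      [k * b, k * b - 1] ++ List.replicate j (g - 1) ++ [b - 1, b] := by
    rw [← hN]
    refine Nat.digits_ofDigits g (by omega) _ ?_ ?_
    · intro d hd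
      simp only [List.mem_append, List.mem_cons, List.mem_replicate, List.not_mem_nil,
        or_false] at hd
      omega
    · intro _
      simpa using hbpos.ne'
  refine ⟨⟨?_, ?_⟩, hdig, ?_⟩
  · refine Nat.pos_of_ne_zero fun h => ?_
    simp [h] at hdig
  · rw [hdig, ← hM]
    simp
  · rw [hdig]
    simp
end

section
/- Let g ≥ 3 and 2 ≤ k < g, and let N be a (g,k)-reverse multiple with exactly n base-g digits. Then N·(g^n + 1) (the number whose base-g expansion is two consecutive copies of the base-g expansion of N) is also a (g,k)-reverse multiple. -/
theorem doubling_reverse_multiple (g k N n : ℕ) (hg : 3 ≤ g) (hk2 : 2 ≤ k) (hkg : k < g)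
    (hN : IsReverseMultiple g k N) (hn : (Nat.digits g N).length = n) :
    IsReverseMultiple g k (N * (g ^ n + 1)) := by
  obtain ⟨hpos, hrev⟩ := hN
  subst hn
  refine ⟨by positivity, ?_⟩
  have hdigits : Nat.digits g (N * (g ^ (Nat.digits g N).length + 1)) =
      Nat.digits g N ++ Nat.digits g N := by
    rw [Nat.digits_append_digits (by omega)]
    congr 1
    ring
  rw [hdigits, List.reverse_append, Nat.ofDigits_append, hrev, List.length_reverse]
  ring
end

section
/- Let g ≥ 3 and 2 ≤ k < g. No (g,k)-reverse multiple is a prime number. -/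
/-- Modulo `g - 1`, reversing the base-`g` digits of a number does not change it. -/
theorem ofDigits_reverse_digits_modEq_pred (g n : ℕ) (hg : 1 ≤ g) :
    Nat.ofDigits g (Nat.digits g n).reverse ≡ n [MOD g - 1] := by
  have h : g ≡ 1 [MOD g - 1] := ((Nat.modEq_iff_dvd' hg).2 dvd_rfl).symm
  calc Nat.ofDigits g (Nat.digits g n).reverse
      ≡ Nat.ofDigits 1 (Nat.digits g n).reverse [MOD g - 1] := Nat.ofDigits_modEq' _ _ _ h _
    _ = Nat.ofDigits 1 (Nat.digits g n) := by simp [Nat.ofDigits_one]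
    _ ≡ Nat.ofDigits g (Nat.digits g n) [MOD g - 1] := (Nat.ofDigits_modEq' _ _ _ h _).symm
    _ = n := Nat.ofDigits_digits g n

theorem reverse_multiple_not_prime (g k N : ℕ) (hg : 3 ≤ g) (hk2 : 2 ≤ k) (hkg : k < g)
    (hN : IsReverseMultiple g k N) : ¬ N.Prime := by
  intro hp
  obtain ⟨hpos, hrev⟩ := hN
  have hmod := ofDigits_reverse_digits_modEq_pred g N (by omega)
  rw [hrev] at hmod
  have hdvd : g - 1 ∣ (k - 1) * N := by
    have := (Nat.modEq_iff_dvd' (Nat.le_mul_of_pos_left N (by omega))).1 hmod.symm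
    rwa [Nat.sub_mul, one_mul]
  rcases Nat.coprime_or_dvd_of_prime hp (g - 1) with hc | hd
  · have := Nat.le_of_dvd (by omega) (hc.symm.dvd_of_dvd_mul_right hdvd)
    omega
  · have hlt : N < g := by
      have := Nat.le_of_dvd (by omega) hd
      omega
    rw [Nat.digits_of_lt g N hpos.ne' hlt, List.reverse_singleton, Nat.ofDigits_singleton] at hrev
    nlinarith
end

section
/- For an integer k with 2 ≤ k ≤ 9, there exists a (10,k)-reverse multiple if and only if k = 4 or k = 9. -/
/-- Constraints on the leading digit `a` and the last digit `b` of a reverse multiple. -/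
theorem IsReverseMultiple.exists_outer_digits {g k N : ℕ} (hg : 1 < g) (hk : 2 ≤ k)
    (h : IsReverseMultiple g k N) :
    ∃ a b : ℕ, 0 < a ∧ a < g ∧ b < g ∧ k * b ≡ a [MOD g] ∧ k * a ≤ b ∧ b < k * (a + 1) := by
  obtain ⟨hN, hrev⟩ := h
  have hlt : ∀ d ∈ Nat.digits g N, d < g := fun d hd => Nat.digits_lt_base hg hd
  have hlast : ∀ h, (Nat.digits g N).getLast h ≠ 0 :=
    fun _ => Nat.getLast_digit_ne_zero g hN.ne'
  have hval := Nat.ofDigits_digits g N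
  have hne : Nat.digits g N ≠ [] := Nat.digits_ne_nil_iff_ne_zero.mpr hN.ne'
  generalize Nat.digits g N = l at *
  obtain _ | ⟨b, t⟩ := l
  · exact absurd rfl hne
  obtain rfl | ⟨m, a, rfl⟩ := List.eq_nil_or_concat' t
  · rw [List.reverse_singleton, hval] at hrev
    nlinarith
  have hmid : Nat.ofDigits g m < g ^ m.length :=
    Nat.ofDigits_lt_base_pow_length hg fun d hd => hlt d (by simp [hd])
  have hmid' : Nat.ofDigits g m.reverse < g ^ m.length := by
    simpa using Nat.ofDigits_lt_base_pow_length (l := m.reverse) hg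
      fun d hd => hlt d (by simp_all)
  have hb : b < g := hlt b (by simp)
  have ha : a < g := hlt a (by simp)
  have ha0 : 0 < a := Nat.pos_of_ne_zero (by simpa using hlast)
  simp only [List.reverse_cons, List.reverse_append, List.reverse_nil, List.nil_append,
    List.cons_append, Nat.ofDigits_cons, Nat.ofDigits_append, Nat.ofDigits_nil,
    List.length_reverse, mul_zero, add_zero] at hrev hval
  generalize Nat.ofDigits g m = M at *
  generalize Nat.ofDigits g m.reverse = M' at *
  generalize g ^ m.length = P at *
  refine ⟨a, b, ha0, ha, hb, ?_, ?_, ?_⟩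
  · have hmod : k * b + g * (k * (M + P * a)) = a + g * (M' + P * b) := by
      rw [hrev, ← hval]; ring
    simpa [Nat.ModEq] using congrArg (· % g) hmod
  · have hlow : g * P * (k * a) ≤ k * N := by
      rw [← hval]
      calc g * P * (k * a) = k * (g * (P * a)) := by ring
        _ ≤ _ := by gcongr; nlinarith
    have hhigh : k * N < g * P * (b + 1) := by
      rw [← hrev]; nlinarith
    exact Nat.lt_succ_iff.mp (Nat.lt_of_mul_lt_mul_left (hlow.trans_lt hhigh))
  · have hlow : g * P * b ≤ k * N := by
      rw [← hrev]; nlinarith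
    have hhigh : k * N < g * P * (k * (a + 1)) := by
      calc k * N < k * (g * P * (a + 1)) := by
            gcongr
            rw [← hval]; nlinarith
        _ = _ := by ring
    exact Nat.lt_of_mul_lt_mul_left (hlow.trans_lt hhigh)

theorem base10_multipliers (k : ℕ) (hk2 : 2 ≤ k) (hk9 : k ≤ 9) :
    (∃ N : ℕ, IsReverseMultiple 10 k N) ↔ k = 4 ∨ k = 9 := by
  constructor
  · rintro ⟨N, hN⟩
    obtain ⟨a, b, ha0, ha, hb, hmod, hle, hlt⟩ := hN.exists_outer_digits (by norm_num) hk2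
    unfold Nat.ModEq at hmod
    interval_cases k <;> interval_cases a <;> omega
  · rintro (rfl | rfl)
    · exact ⟨2178, by norm_num [IsReverseMultiple, Nat.ofDigits_cons]⟩
    · exact ⟨1089, by norm_num [IsReverseMultiple, Nat.ofDigits_cons]⟩
end

section
/- For every integer t ≥ 4, the number of (10,4)-reverse multiples having exactly t decimal digits equals the Fibonacci number F_{⌊t/2⌋−1} (with F_1 = F_2 = 1), and there are none with fewer than 4 digits. -/
namespace ReverseMultiple

/-- Digit lists `L` of length `t`, least significant digit first, such that `4 * L`, computed with
incoming carry `a` and outgoing carry `b`, is the reversal of `L`. -/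
def carrySolutions (a b t : ℕ) : Set (List ℕ) :=
  {L | L.length = t ∧ (∀ d ∈ L, d < 10) ∧
    4 * Nat.ofDigits 10 L + a = Nat.ofDigits 10 L.reverse + b * 10 ^ t}

/-- Add the least significant digit `d` and the most significant digit `e` to `M`. -/
def wrap (d e : ℕ) (M : List ℕ) : List ℕ := d :: (M ++ [e])

theorem wrap_injective (d e : ℕ) : Function.Injective (wrap d e) := by
  intro M M' h
  simpa [wrap] using h

theorem exists_eq_wrap {t : ℕ} {L : List ℕ} (h : L.length = t + 2) :
    ∃ d e M, L = wrap d e M := by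
  obtain - | ⟨d, L⟩ := L
  · simp at h
  · obtain rfl | ⟨M, e, rfl⟩ := L.eq_nil_or_concat
    · simp at h
    · exact ⟨d, e, M, by simp [wrap]⟩

/-- Multiplication by `4` acts on the outermost pair of digits as a transition between pairs of
carries. -/
theorem wrap_mem_carrySolutions_iff {a b d e t : ℕ} {M : List ℕ} (ha : a ≤ 3) :
    wrap d e M ∈ carrySolutions a b (t + 2) ↔ d < 10 ∧ e < 10 ∧
      ∃ a' ≤ 3, ∃ b' ≤ 3, 4 * d + a = e + 10 * a' ∧ 4 * e + b' = d + 10 * b ∧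
        M ∈ carrySolutions a' b' t := by
  have hN : Nat.ofDigits 10 (wrap d e M)
      = d + 10 * (Nat.ofDigits 10 M + 10 ^ M.length * e) := by
    simp [wrap, Nat.ofDigits_cons, Nat.ofDigits_append]
  have hR : Nat.ofDigits 10 (wrap d e M).reverse
      = e + 10 * (Nat.ofDigits 10 M.reverse + 10 ^ M.length * d) := by
    simp [wrap, Nat.ofDigits_cons, Nat.ofDigits_append]
  have hlen : (wrap d e M).length = M.length + 2 := by simp [wrap]
  have hdig : (∀ x ∈ wrap d e M, x < 10) ↔ d < 10 ∧ e < 10 ∧ ∀ x ∈ M, x < 10 := by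
    simp only [wrap, List.mem_cons, List.mem_append, List.not_mem_nil, or_false]
    constructor
    · exact fun h => ⟨h d (.inl rfl), h e (.inr (.inr rfl)), fun x hx => h x (.inr (.inl hx))⟩
    · rintro ⟨hd, he, hM⟩ x (rfl | hx | rfl)
      exacts [hd, hM x hx, he]
  simp only [carrySolutions, Set.mem_ofPred_eq, hN, hR, hlen, hdig, Nat.add_right_cancel_iff]
  constructor
  · rintro ⟨rfl, ⟨hd, he, hM⟩, h⟩
    have hMlt : Nat.ofDigits 10 M < 10 ^ M.length :=
      Nat.ofDigits_lt_base_pow_length (by norm_num) hM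
    have hRlt : Nat.ofDigits 10 M.reverse < 10 ^ M.length := by
      simpa using Nat.ofDigits_lt_base_pow_length (b := 10) (l := M.reverse) (by norm_num)
        (by simpa using hM)
    rw [pow_add] at h
    generalize 10 ^ M.length = T at *
    generalize Nat.ofDigits 10 M = m at *
    generalize Nat.ofDigits 10 M.reverse = r at *
    obtain ⟨a', ha'⟩ : ∃ a', 4 * d + a = e + 10 * a' := by
      refine ⟨(4 * d + a - e) / 10, ?_⟩
      generalize T * e = x at *
      generalize T * d = y at *
      have : b * (T * 10 ^ 2) = 100 * (b * T) := by ring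
      rw [this] at h
      generalize b * T = z at *
      omega
    have key : 4 * m + a' + T * (4 * e) = r + T * (d + 10 * b) := by
      have : b * (T * 10 ^ 2) = 100 * (T * b) := by ring
      linarith
    have hle : 4 * e ≤ d + 10 * b := by
      by_contra! hlt
      nlinarith
    obtain ⟨b', hb'⟩ := Nat.exists_eq_add_of_le hle
    rw [hb'] at key
    have key' : 4 * m + a' = r + b' * T := by linarith
    refine ⟨hd, he, a', by omega, b', ?_, ha', hb'.symm, rfl, hM, key'⟩
    by_contra! hlt
    have : a' ≤ 3 := by omega
    nlinarith
  · rintro ⟨hd, he, a', -, b', -, h₁, h₂, rfl, hM, h⟩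
    refine ⟨rfl, ⟨hd, he, hM⟩, ?_⟩
    rw [pow_add]
    generalize 10 ^ M.length = T at *
    have h₂' : T * (4 * e + b') = T * (d + 10 * b) := by rw [h₂]
    linarith

theorem carrySolutions_zero_zero (t : ℕ) : carrySolutions 0 0 (t + 2) =
    wrap 0 0 '' carrySolutions 0 0 t ∪ wrap 8 2 '' carrySolutions 3 0 t := by
  ext L
  constructor
  · intro h
    obtain ⟨d, e, M, rfl⟩ := exists_eq_wrap h.1
    obtain ⟨hd, he, a, ha, b, hb, h₁, h₂, hM⟩ :=
      (wrap_mem_carrySolutions_iff (by norm_num)).1 h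
    obtain ⟨rfl, rfl, rfl, rfl⟩ | ⟨rfl, rfl, rfl, rfl⟩ :
        (d = 0 ∧ e = 0 ∧ a = 0 ∧ b = 0) ∨ (d = 8 ∧ e = 2 ∧ a = 3 ∧ b = 0) := by omega
    · exact .inl ⟨M, hM, rfl⟩
    · exact .inr ⟨M, hM, rfl⟩
  · rintro (⟨M, hM, rfl⟩ | ⟨M, hM, rfl⟩)
    · exact (wrap_mem_carrySolutions_iff (by norm_num)).2
        ⟨by norm_num, by norm_num, 0, by norm_num, 0, by norm_num, rfl, rfl, hM⟩
    · exact (wrap_mem_carrySolutions_iff (by norm_num)).2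
        ⟨by norm_num, by norm_num, 3, by norm_num, 0, by norm_num, rfl, rfl, hM⟩

theorem carrySolutions_three_zero (t : ℕ) : carrySolutions 3 0 (t + 2) =
    wrap 7 1 '' carrySolutions 3 3 t := by
  ext L
  constructor
  · intro h
    obtain ⟨d, e, M, rfl⟩ := exists_eq_wrap h.1
    obtain ⟨hd, he, a, ha, b, hb, h₁, h₂, hM⟩ :=
      (wrap_mem_carrySolutions_iff (by norm_num)).1 h
    obtain ⟨rfl, rfl, rfl, rfl⟩ : d = 7 ∧ e = 1 ∧ a = 3 ∧ b = 3 := by omega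
    exact ⟨M, hM, rfl⟩
  · rintro ⟨M, hM, rfl⟩
    exact (wrap_mem_carrySolutions_iff (by norm_num)).2
      ⟨by norm_num, by norm_num, 3, by norm_num, 3, by norm_num, rfl, rfl, hM⟩

theorem carrySolutions_three_three (t : ℕ) : carrySolutions 3 3 (t + 2) =
    wrap 9 9 '' carrySolutions 3 3 t ∪ wrap 1 7 '' carrySolutions 0 3 t := by
  ext L
  constructor
  · intro h
    obtain ⟨d, e, M, rfl⟩ := exists_eq_wrap h.1
    obtain ⟨hd, he, a, ha, b, hb, h₁, h₂, hM⟩ :=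
      (wrap_mem_carrySolutions_iff (by norm_num)).1 h
    obtain ⟨rfl, rfl, rfl, rfl⟩ | ⟨rfl, rfl, rfl, rfl⟩ :
        (d = 9 ∧ e = 9 ∧ a = 3 ∧ b = 3) ∨ (d = 1 ∧ e = 7 ∧ a = 0 ∧ b = 3) := by omega
    · exact .inl ⟨M, hM, rfl⟩
    · exact .inr ⟨M, hM, rfl⟩
  · rintro (⟨M, hM, rfl⟩ | ⟨M, hM, rfl⟩)
    · exact (wrap_mem_carrySolutions_iff (by norm_num)).2
        ⟨by norm_num, by norm_num, 3, by norm_num, 3, by norm_num, rfl, rfl, hM⟩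
    · exact (wrap_mem_carrySolutions_iff (by norm_num)).2
        ⟨by norm_num, by norm_num, 0, by norm_num, 3, by norm_num, rfl, rfl, hM⟩

theorem carrySolutions_zero_three (t : ℕ) : carrySolutions 0 3 (t + 2) =
    wrap 2 8 '' carrySolutions 0 0 t := by
  ext L
  constructor
  · intro h
    obtain ⟨d, e, M, rfl⟩ := exists_eq_wrap h.1
    obtain ⟨hd, he, a, ha, b, hb, h₁, h₂, hM⟩ :=
      (wrap_mem_carrySolutions_iff (by norm_num)).1 h
    obtain ⟨rfl, rfl, rfl, rfl⟩ : d = 2 ∧ e = 8 ∧ a = 0 ∧ b = 0 := by omega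
    exact ⟨M, hM, rfl⟩
  · rintro ⟨M, hM, rfl⟩
    exact (wrap_mem_carrySolutions_iff (by norm_num)).2
      ⟨by norm_num, by norm_num, 0, by norm_num, 0, by norm_num, rfl, rfl, hM⟩

theorem encard_wrap_image (d e : ℕ) (S : Set (List ℕ)) : (wrap d e '' S).encard = S.encard :=
  (wrap_injective d e).encard_image S

theorem encard_wrap_union {d e d' e' : ℕ} (h : d ≠ d') (S S' : Set (List ℕ)) :
    (wrap d e '' S ∪ wrap d' e' '' S').encard = S.encard + S'.encard := by
  rw [Set.encard_union_eq, encard_wrap_image, encard_wrap_image]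
  rw [Set.disjoint_left]
  rintro _ ⟨M, -, rfl⟩ ⟨M', -, h'⟩
  exact h (List.cons.inj h').1.symm

theorem carrySolutions_length_zero (a b : ℕ) :
    carrySolutions a b 0 = {L | L = [] ∧ a = b} := by
  ext L
  simp only [carrySolutions, Set.mem_ofPred_eq, List.length_eq_zero_iff]
  constructor
  · rintro ⟨rfl, -, h⟩
    simpa using h
  · rintro ⟨rfl, rfl⟩
    simp

theorem carrySolutions_length_one (a b : ℕ) :
    carrySolutions a b 1 = {L | ∃ d < 10, L = [d] ∧ 4 * d + a = d + b * 10} := by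
  ext L
  simp only [carrySolutions, Set.mem_ofPred_eq, List.length_eq_one_iff]
  constructor
  · rintro ⟨⟨d, rfl⟩, hd, h⟩
    exact ⟨d, by simpa using hd, rfl, by simpa using h⟩
  · rintro ⟨d, hd, rfl, h⟩
    exact ⟨⟨d, rfl⟩, by simpa using hd, by simpa using h⟩

theorem carrySolutions_diag_of_lt_two {c r : ℕ} (hc : c ≤ 3) (hr : r < 2) :
    carrySolutions (3 * (c / 3)) (3 * (c / 3)) r = {List.replicate r (9 * (c / 3))} := by
  obtain rfl | rfl : r = 0 ∨ r = 1 := by omega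
  · simp [carrySolutions_length_zero]
  · rw [carrySolutions_length_one]
    ext L
    simp only [Set.mem_ofPred_eq, Set.mem_singleton_iff, List.replicate_one]
    constructor
    · rintro ⟨d, hd, rfl, h⟩
      congr 1
      omega
    · rintro rfl
      exact ⟨_, by omega, rfl, by omega⟩

theorem carrySolutions_eq_empty_of_lt_two {a b r : ℕ} (h : a = 3 ∧ b = 0 ∨ a = 0 ∧ b = 3)
    (hr : r < 2) : carrySolutions a b r = ∅ := by
  obtain rfl | rfl : r = 0 ∨ r = 1 := by omega
  · rw [carrySolutions_length_zero]
    ext L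
    simp
    omega
  · rw [carrySolutions_length_one]
    ext L
    simp only [Set.mem_ofPred_eq, Set.mem_empty_iff_false, iff_false]
    rintro ⟨d, hd, -, h'⟩
    omega

theorem encard_carrySolutions {r : ℕ} (hr : r < 2) (m : ℕ) :
    (carrySolutions 0 0 (2 * m + r)).encard = Nat.fib (m + 1) ∧
    (carrySolutions 3 3 (2 * m + r)).encard = Nat.fib (m + 1) ∧
    (carrySolutions 3 0 (2 * m + r)).encard = Nat.fib m ∧
    (carrySolutions 0 3 (2 * m + r)).encard = Nat.fib m := by
  induction m with
  | zero =>
    have h₀ := carrySolutions_diag_of_lt_two (c := 0) (by norm_num) hr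
    have h₃ := carrySolutions_diag_of_lt_two (c := 3) (by norm_num) hr
    norm_num at h₀ h₃
    simp [h₀, h₃, carrySolutions_eq_empty_of_lt_two, hr]
  | succ m ih =>
    obtain ⟨h₀₀, h₃₃, h₃₀, h₀₃⟩ := ih
    have ht : 2 * (m + 1) + r = 2 * m + r + 2 := by ring
    have hfib : Nat.fib (m + 1 + 1) = Nat.fib (m + 1) + Nat.fib m := by
      rw [Nat.fib_add_two, add_comm]
    rw [ht, carrySolutions_zero_zero, carrySolutions_three_three, carrySolutions_three_zero,
      carrySolutions_zero_three, encard_wrap_union (by norm_num), encard_wrap_union (by norm_num),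
      encard_wrap_image, encard_wrap_image, h₀₀, h₃₃, h₃₀, h₀₃, hfib]
    simp

theorem digits_mem_carrySolutions {N t : ℕ} (h : IsReverseMultiple 10 4 N)
    (ht : (Nat.digits 10 N).length = t) : Nat.digits 10 N ∈ carrySolutions 0 0 t :=
  ⟨ht, fun _ hd => Nat.digits_lt_base (by norm_num) hd, by
    rw [h.2, Nat.ofDigits_digits]; ring⟩

theorem two_le_length_digits {N : ℕ} (h : IsReverseMultiple 10 4 N) :
    2 ≤ (Nat.digits 10 N).length := by
  have hne : Nat.digits 10 N ≠ [] := Nat.digits_ne_nil_iff_ne_zero.2 h.1.ne'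
  by_contra! hlt
  have hpos := List.length_pos_iff.2 hne
  have hmem := digits_mem_carrySolutions h (t := 1) (by omega)
  rw [carrySolutions_length_one] at hmem
  obtain ⟨d, -, hd, h'⟩ := hmem
  have hN := Nat.ofDigits_digits 10 N
  rw [hd, Nat.ofDigits_singleton] at hN
  have := h.1
  omega

theorem digits_image_eq (t : ℕ) :
    Nat.digits 10 '' {N | IsReverseMultiple 10 4 N ∧ (Nat.digits 10 N).length = t + 2} =
      wrap 8 2 '' carrySolutions 3 0 t := by
  ext L
  constructor
  · rintro ⟨N, ⟨h, ht⟩, rfl⟩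
    have hmem := digits_mem_carrySolutions h ht
    rw [carrySolutions_zero_zero] at hmem
    obtain ⟨M, -, hM⟩ | hmem := hmem
    · have hlast := Nat.getLast_digit_ne_zero 10 h.1.ne'
      simp [← hM, wrap] at hlast
    · exact hmem
  · intro hL
    have hmem : L ∈ carrySolutions 0 0 (t + 2) := by
      rw [carrySolutions_zero_zero]
      exact .inr hL
    obtain ⟨M, -, rfl⟩ := hL
    have hdig : Nat.digits 10 (Nat.ofDigits 10 (wrap 8 2 M)) = wrap 8 2 M :=
      Nat.digits_ofDigits 10 (by norm_num) _ hmem.2.1 (by simp [wrap])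
    refine ⟨_, ⟨⟨?_, ?_⟩, ?_⟩, hdig⟩
    · simp [wrap, Nat.ofDigits_cons]
    · rw [hdig]
      have := hmem.2.2
      omega
    · rw [hdig]
      exact hmem.1

theorem encard_reverseMultiples (t : ℕ) :
    {N | IsReverseMultiple 10 4 N ∧ (Nat.digits 10 N).length = t}.encard
      = Nat.fib (t / 2 - 1) := by
  obtain ht | ht := lt_or_ge t 2
  · rw [show t / 2 - 1 = 0 by omega, Nat.fib_zero, Nat.cast_zero, Set.encard_eq_zero,
      Set.eq_empty_iff_forall_notMem]
    rintro N ⟨h, hN⟩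
    have := two_le_length_digits h
    omega
  · obtain ⟨s, rfl⟩ := Nat.exists_eq_add_of_le' ht
    rw [← (Nat.digits.injective 10).encard_image, digits_image_eq, encard_wrap_image]
    have := (encard_carrySolutions (Nat.mod_lt s two_pos) (s / 2)).2.2.1
    rwa [Nat.div_add_mod, show s / 2 = (s + 2) / 2 - 1 by omega] at this

end ReverseMultiple

theorem count_reverse_multiples_10_4 (t : ℕ) :
    (4 ≤ t →
      {N : ℕ | IsReverseMultiple 10 4 N ∧ (Nat.digits 10 N).length = t}.ncard
        = Nat.fib (t / 2 - 1)) ∧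
    (t < 4 →
      {N : ℕ | IsReverseMultiple 10 4 N ∧ (Nat.digits 10 N).length = t} = ∅) := by
  have h := ReverseMultiple.encard_reverseMultiples t
  constructor
  · intro _
    rw [Set.ncard, h, ENat.toNat_natCast]
  · intro ht
    rw [show t / 2 - 1 = 0 by omega, Nat.fib_zero, Nat.cast_zero, Set.encard_eq_zero] at h
    exact h
end

section
/- Let g ≥ 4. There exist an integer k with 2 ≤ k < g and a (g,k)-reverse multiple N having exactly two base-g digits if and only if g + 1 is not prime. -/
/-- Two-digit reverse multiples, in terms of the digits `a` (units) and `b` (leading). -/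
theorem exists_isReverseMultiple_length_two_iff {g k : ℕ} (hg : 1 < g) :
    (∃ N, IsReverseMultiple g k N ∧ (Nat.digits g N).length = 2) ↔
      ∃ a b : ℕ, a < g ∧ b < g ∧ 0 < b ∧ b + g * a = k * (a + g * b) := by
  constructor
  · rintro ⟨N, ⟨-, hrev⟩, hlen⟩
    obtain ⟨a, b, hab⟩ := List.length_eq_two.mp hlen
    have hN : N = a + g * b := by
      rw [← Nat.ofDigits_digits g N, hab]
      simp [Nat.ofDigits]
    refine ⟨a, b, Nat.digits_lt_base (m := N) hg (by simp [hab]),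
      Nat.digits_lt_base (m := N) hg (by simp [hab]), ?_, ?_⟩
    · have h := Nat.getLast_digit_ne_zero g (m := N) (by rintro rfl; simp at hlen)
      simp only [hab] at h
      exact Nat.pos_of_ne_zero (by simpa using h)
    · rw [hab, hN] at hrev
      simpa [Nat.ofDigits] using hrev
  · rintro ⟨a, b, ha, hb, hb0, h⟩
    have hdig : Nat.digits g (a + g * b) = [a, b] := by
      rw [Nat.digits_add g hg a b ha (Or.inr hb0.ne'), Nat.digits_of_lt g b hb0.ne' hb]
    refine ⟨a + g * b, ⟨by positivity, ?_⟩, by simp [hdig]⟩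
    rw [hdig]
    simpa [Nat.ofDigits] using h

/-- If `g + 1` is prime, then no two-digit number in base `g` is reversed by a nontrivial
multiplier. -/
theorem reversal_ne_mul_of_prime {g k a b : ℕ} (hp : (g + 1).Prime) (hk : 2 ≤ k) (hkg : k < g)
    (ha : a < g) (hb : b < g) (hb0 : 0 < b) : b + g * a ≠ k * (a + g * b) := by
  intro h
  have hdvd : ((g + 1 : ℕ) : ℤ) ∣ ((k + 1 : ℕ) : ℤ) * ((a : ℤ) - b) := by
    refine ⟨a - k * b, ?_⟩
    zify at h
    push_cast
    linear_combination -h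
  rcases (Nat.prime_iff_prime_int.mp hp).dvd_or_dvd hdvd with h1 | h1
  · have := Nat.le_of_dvd (by omega) (Int.natCast_dvd_natCast.mp h1)
    omega
  · have hab : a = b := by
      have := Int.eq_zero_of_abs_lt_dvd h1 (by rw [abs_lt]; constructor <;> push_cast <;> omega)
      omega
    subst hab
    nlinarith [Nat.mul_le_mul_right (a + g * a) hk, Nat.zero_le (g * a)]

/-- A factorization `g + 1 = m * n` yields the two-digit reverse multiple with digits
`m - 1` and `g - m` and multiplier `n - 1`. -/
theorem exists_reversal_eq_mul_of_factorization {g m n : ℕ} (hm : 2 ≤ m) (hn : 3 ≤ n)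
    (h : g + 1 = m * n) :
    ∃ k, 2 ≤ k ∧ k < g ∧ ∃ a b, a < g ∧ b < g ∧ 0 < b ∧ b + g * a = k * (a + g * b) := by
  have hmg : m < g := by nlinarith
  have hng : n ≤ g := by nlinarith
  refine ⟨n - 1, by omega, by omega, g - m, m - 1, by omega, by omega, by omega, ?_⟩
  zify [hmg.le, show 1 ≤ m by omega, show 1 ≤ n by omega] at h ⊢
  rw [show (g : ℤ) = m * n - 1 by linarith]
  ring

theorem two_digit_reverse_multiple_iff (g : ℕ) (hg : 4 ≤ g) :
    (∃ k N : ℕ, 2 ≤ k ∧ k < g ∧ IsReverseMultiple g k N ∧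
        (Nat.digits g N).length = 2) ↔ ¬ (g + 1).Prime := by
  constructor
  · rintro ⟨k, N, hk, hkg, hN⟩ hp
    obtain ⟨a, b, ha, hb, hb0, h⟩ :=
      (exists_isReverseMultiple_length_two_iff (by omega)).mp ⟨N, hN⟩
    exact reversal_ne_mul_of_prime hp hk hkg ha hb hb0 h
  · intro hp
    obtain ⟨m, n, hm, hn, h⟩ : ∃ m n, 2 ≤ m ∧ 3 ≤ n ∧ g + 1 = m * n := by
      obtain ⟨m, n, hm, hn, h⟩ := (Nat.not_prime_iff_exists_mul_eq (by omega)).mp hp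
      have hm2 : 2 ≤ m := by by_contra! hlt; interval_cases m <;> omega
      have hn2 : 2 ≤ n := by by_contra! hlt; interval_cases n <;> omega
      rcases Nat.lt_or_ge n 3 with hn3 | hn3
      · exact ⟨n, m, hn2, by interval_cases n; omega, by rw [mul_comm, h]⟩
      · exact ⟨m, n, hm2, hn3, h.symm⟩
    obtain ⟨k, hk, hkg, hab⟩ := exists_reversal_eq_mul_of_factorization hm hn h
    obtain ⟨N, hN⟩ := (exists_isReverseMultiple_length_two_iff (by omega)).mpr hab
    exact ⟨k, N, hk, hkg, hN⟩
end

section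
/- Let g ≥ 3 and 2 ≤ k < g, and let N be a (g,k)-reverse multiple with at least two base-g digits. Then the least significant base-g digit a_0 = N mod g is nonzero, and moreover k·a_0 ≥ g (i.e., the first carry r_0 in the multiplication of N by k in base g is positive). -/
theorem first_digit_ne_zero_and_first_carry_pos (g k N : ℕ) (hg : 3 ≤ g) (hk2 : 2 ≤ k)
    (hkg : k < g) (hN : IsReverseMultiple g k N) (hlen : 2 ≤ (Nat.digits g N).length) :
    N % g ≠ 0 ∧ g ≤ k * (N % g) := by
  obtain ⟨hpos, hrev⟩ := hN
  obtain ⟨a, m, b, hL⟩ : ∃ a m b, Nat.digits g N = a :: (m ++ [b]) := by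
    match h : Nat.digits g N with
    | [] => simp [h] at hlen
    | [_] => simp [h] at hlen
    | a :: c :: l =>
      exact ⟨a, (c :: l).dropLast, (c :: l).getLast (by simp),
        by rw [List.dropLast_append_getLast]⟩
  have hdigit : ∀ d ∈ Nat.digits g N, d < g := fun d hd => Nat.digits_lt_base (by omega) hd
  have hb : b ≠ 0 := by
    have h := Nat.getLast_digit_ne_zero g hpos.ne'
    simpa [hL] using h
  have hval : N = a + g * (Nat.ofDigits g m + g ^ m.length * b) := by
    conv_lhs => rw [← Nat.ofDigits_digits g N, hL]
    simp [Nat.ofDigits_cons, Nat.ofDigits_append]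
  have hrev_val : k * N = b + g * Nat.ofDigits g m.reverse + g ^ (m.length + 1) * a := by
    rw [← hrev, hL]
    simp [Nat.ofDigits_cons, Nat.ofDigits_append]
    ring
  have hag : a < g := hdigit a (by simp [hL])
  have hbg : b < g := hdigit b (by simp [hL])
  have hmod : N % g = a := by
    rw [hval, Nat.add_mul_mod_self_left, Nat.mod_eq_of_lt hag]
  have hlow : b + g * Nat.ofDigits g m.reverse < g ^ (m.length + 1) := by
    have h := Nat.ofDigits_lt_base_pow_length (b := g) (l := b :: m.reverse) (by omega)
      (fun d hd => hdigit d (by rw [hL]; simp at hd ⊢; tauto))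
    simpa [Nat.ofDigits_cons] using h
  have hkb : k * b ≤ a := by
    have hNb : g ^ (m.length + 1) * b ≤ N := by
      rw [pow_succ', mul_assoc]
      nlinarith [Nat.zero_le (g * Nat.ofDigits g m)]
    have h : g ^ (m.length + 1) * (k * b) < g ^ (m.length + 1) * (a + 1) := by
      nlinarith [Nat.mul_le_mul_left k hNb]
    exact Nat.lt_succ_iff.mp (Nat.lt_of_mul_lt_mul_left h)
  rw [hmod]
  have hb_pos : 0 < b := Nat.pos_of_ne_zero hb
  refine ⟨by nlinarith, ?_⟩
  by_contra! hlt
  have hcong : b = k * a := by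
    have h := congrArg (· % g) hrev_val
    simpa [hmod, Nat.mul_mod, pow_succ', mul_assoc, add_assoc, Nat.add_mod,
      Nat.mod_eq_of_lt hbg, Nat.mod_eq_of_lt hlt, Nat.mod_eq_of_lt hkg, Nat.mod_eq_of_lt hag]
      using h.symm
  nlinarith
end
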